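/- arXiv:1307.0071 — 6 statements merged into one kernel-verified Lean document; each statement's English description precedes it below -/
import Mathlib

section
/- Let P ⊆ ℝ^n be a polytope with 0 in its interior. Then P is perfectly centered if and only if P is balanced with itself, i.e., for all nonempty faces G and F of P: relint(ncone(P, G)) ∩ relint(F) ≠ ∅ if and only if G ⊆ F. -/
open RealInnerProductSpace

/-- A polytope is the convex hull of a finite set of points. -/
def IsPolytope {n : ℕ} (P : Set (EuclideanSpace ℝ (Fin n))) : Prop :=
  ∃ S : Finset (EuclideanSpace ℝ (Fin n)), P = convexHull ℝ (S : Set (EuclideanSpace ℝ (Fin n)))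

/-- An (exposed) face of `P`: a set of the form `{x ∈ P | ∀ y ∈ P, ⟪c, y⟫ ≤ ⟪c, x⟫}`. -/
def IsFace {n : ℕ} (P F : Set (EuclideanSpace ℝ (Fin n))) : Prop :=
  ∃ c : EuclideanSpace ℝ (Fin n), F = {x ∈ P | ∀ y ∈ P, ⟪c, y⟫ ≤ ⟪c, x⟫}

/-- The normal cone of a face `F` of a polytope `P`. -/
def ncone {n : ℕ} (P F : Set (EuclideanSpace ℝ (Fin n))) : Set (EuclideanSpace ℝ (Fin n)) :=
  {y | ∀ p ∈ P, ∀ f ∈ F, ⟪y, p⟫ ≤ ⟪y, f⟫}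

/-- A polytope is perfectly centered if for each nonempty face `F`, the orthogonal
projection of the origin onto the affine span of `F` lies in the relative interior of `F`. -/
def PerfectlyCentered {n : ℕ} (P : Set (EuclideanSpace ℝ (Fin n))) : Prop :=
  ∀ F, IsFace P F → F.Nonempty →
    ∃ p ∈ intrinsicInterior ℝ F, ∀ x ∈ affineSpan ℝ F, ⟪x - p, p⟫ = 0

open Filter Topology

section IntrinsicInterior

variable {E : Type*} [NormedAddCommGroup E] [NormedSpace ℝ E] {s : Set E} {x y : E}

lemma mem_intrinsicInterior_iff_eventually :
    x ∈ intrinsicInterior ℝ s ↔ x ∈ s ∧ ∀ᶠ z in 𝓝 x, z ∈ affineSpan ℝ s → z ∈ s := by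
  constructor
  · intro h
    refine ⟨intrinsicInterior_subset h, ?_⟩
    obtain ⟨w, hw, rfl⟩ := mem_intrinsicInterior.1 h
    rw [mem_interior_iff_mem_nhds, nhds_subtype_eq_comap] at hw
    obtain ⟨t, ht, hts⟩ := hw
    filter_upwards [ht] with z hz hzs
    exact @hts ⟨z, hzs⟩ hz
  · rintro ⟨hx, h⟩
    refine mem_intrinsicInterior.2 ⟨⟨x, subset_affineSpan ℝ s hx⟩, ?_, rfl⟩
    rw [mem_interior_iff_mem_nhds, nhds_subtype_eq_comap]
    exact ⟨_, h, fun z hz => hz z.2⟩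

lemma combo_mem_intrinsicInterior (hs : Convex ℝ s) (hx : x ∈ intrinsicInterior ℝ s)
    (hy : y ∈ s) {a b : ℝ} (ha : 0 < a) (hb : 0 ≤ b) (hab : a + b = 1) :
    a • x + b • y ∈ intrinsicInterior ℝ s := by
  rw [mem_intrinsicInterior_iff_eventually] at hx ⊢
  obtain ⟨hxs, hx⟩ := hx
  have hw : a • x + b • y ∈ s := hs hxs hy ha.le hb hab
  refine ⟨hw, ?_⟩
  have hc : Tendsto (fun z : E => a⁻¹ • (z - (a • x + b • y)) + x)
      (𝓝 (a • x + b • y)) (𝓝 x) := by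
    have : Continuous (fun z : E => a⁻¹ • (z - (a • x + b • y)) + x) := by fun_prop
    simpa using this.tendsto (a • x + b • y)
  filter_upwards [hc.eventually hx] with z hz hzs
  have h := hz (AffineSubspace.smul_vsub_vadd_mem _ a⁻¹ hzs (subset_affineSpan ℝ s hw)
    (subset_affineSpan ℝ s hxs))
  convert hs h hy ha.le hb hab using 1
  rw [smul_add, smul_smul, mul_inv_cancel₀ ha.ne']
  module

lemma exists_extend_of_mem_intrinsicInterior (hx : x ∈ intrinsicInterior ℝ s) (hy : y ∈ s) :
    ∃ ε : ℝ, 0 < ε ∧ x + ε • (x - y) ∈ s := by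
  rw [mem_intrinsicInterior_iff_eventually] at hx
  obtain ⟨hxs, hx⟩ := hx
  have hc : Tendsto (fun t : ℝ => t • (x - y) + x) (𝓝[>] 0) (𝓝 x) := by
    have : Continuous (fun t : ℝ => t • (x - y) + x) := by fun_prop
    simpa using (this.tendsto 0).mono_left nhdsWithin_le_nhds
  obtain ⟨t, ht, ht0⟩ := ((hc.eventually hx).and self_mem_nhdsWithin).exists
  refine ⟨t, ht0, ?_⟩
  rw [add_comm]
  exact ht (AffineSubspace.smul_vsub_vadd_mem _ t (subset_affineSpan ℝ s hxs)
    (subset_affineSpan ℝ s hy) (subset_affineSpan ℝ s hxs))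

end IntrinsicInterior

section Faces

variable {n : ℕ} {P : Set (EuclideanSpace ℝ (Fin n))}

/-- The face of `P` on which the functional `⟪c, ·⟫` attains its maximum. -/
def exposedFace (P : Set (EuclideanSpace ℝ (Fin n))) (c : EuclideanSpace ℝ (Fin n)) :
    Set (EuclideanSpace ℝ (Fin n)) :=
  {x ∈ P | ∀ y ∈ P, ⟪c, y⟫ ≤ ⟪c, x⟫}

lemma inner_eq_of_mem_exposedFace {c x y : EuclideanSpace ℝ (Fin n)}
    (hx : x ∈ exposedFace P c) (hy : y ∈ exposedFace P c) : ⟪c, x⟫ = ⟪c, y⟫ :=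
  le_antisymm (hy.2 x hx.1) (hx.2 y hy.1)

lemma mem_exposedFace_of_le {c x y : EuclideanSpace ℝ (Fin n)}
    (hx : x ∈ exposedFace P c) (hy : y ∈ P) (h : ⟪c, x⟫ ≤ ⟪c, y⟫) : y ∈ exposedFace P c :=
  ⟨hy, fun z hz => (hx.2 z hz).trans h⟩

lemma inner_lt_of_notMem_exposedFace {c x y : EuclideanSpace ℝ (Fin n)}
    (hx : x ∈ exposedFace P c) (hy : y ∈ P) (h : y ∉ exposedFace P c) : ⟪c, y⟫ < ⟪c, x⟫ :=
  lt_of_not_ge fun hle => h (mem_exposedFace_of_le hx hy hle)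

lemma convex_exposedFace (hP : Convex ℝ P) (c : EuclideanSpace ℝ (Fin n)) :
    Convex ℝ (exposedFace P c) := by
  intro x hx y hy a b ha hb hab
  refine mem_exposedFace_of_le hx (hP hx.1 hy.1 ha hb hab) ?_
  rw [inner_add_right, inner_smul_right, inner_smul_right, inner_eq_of_mem_exposedFace hy hx,
    ← add_mul, hab, one_mul]

lemma inner_le_of_mem_convexHull {S : Set (EuclideanSpace ℝ (Fin n))}
    {c x : EuclideanSpace ℝ (Fin n)} {a : ℝ} (h : ∀ v ∈ S, ⟪c, v⟫ ≤ a)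
    (hx : x ∈ convexHull ℝ S) : ⟪c, x⟫ ≤ a :=
  convexHull_min (t := {z | ⟪c, z⟫ ≤ a}) h
    (convex_halfSpace_le (innerₛₗ ℝ c).isLinear a) hx

lemma exists_pos_smul_mem (h0 : (0 : EuclideanSpace ℝ (Fin n)) ∈ interior P)
    (d : EuclideanSpace ℝ (Fin n)) : ∃ ε : ℝ, 0 < ε ∧ ε • d ∈ P := by
  have hc : Tendsto (fun t : ℝ => t • d) (𝓝[>] 0) (𝓝 0) := by
    have : Continuous (fun t : ℝ => t • d) := by fun_prop
    simpa using (this.tendsto 0).mono_left nhdsWithin_le_nhds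
  obtain ⟨t, ht, ht0⟩ :=
    ((hc.eventually (mem_interior_iff_mem_nhds.1 h0)).and self_mem_nhdsWithin).exists
  exact ⟨t, ht0, ht⟩

lemma inner_pos_of_mem_exposedFace (h0 : (0 : EuclideanSpace ℝ (Fin n)) ∈ interior P)
    {d k : EuclideanSpace ℝ (Fin n)} (hd : d ≠ 0) (hk : k ∈ exposedFace P d) : 0 < ⟪d, k⟫ := by
  obtain ⟨ε, hε, h⟩ := exists_pos_smul_mem h0 d
  refine lt_of_lt_of_le ?_ (hk.2 _ h)
  rw [inner_smul_right]
  exact mul_pos hε (real_inner_self_pos.2 hd)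

lemma inner_eq_of_mem_affineSpan {s : Set (EuclideanSpace ℝ (Fin n))}
    {c z : EuclideanSpace ℝ (Fin n)} {a : ℝ} (h : ∀ x ∈ s, ⟪c, x⟫ = a)
    (hz : z ∈ affineSpan ℝ s) : ⟪c, z⟫ = a := by
  refine affineSpan_induction (p := fun z => ⟪c, z⟫ = a) hz h ?_
  intro t u v w hu hv hw
  simp [inner_add_right, inner_smul_right, inner_sub_right, hu, hv, hw]

lemma mem_intrinsicInterior_ncone_iff (hP : IsPolytope P) {c y : EuclideanSpace ℝ (Fin n)}
    (hne : (exposedFace P c).Nonempty) :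
    y ∈ intrinsicInterior ℝ (ncone P (exposedFace P c)) ↔ exposedFace P y = exposedFace P c := by
  obtain ⟨g, hg⟩ := hne
  constructor
  · intro h
    have hy := intrinsicInterior_subset h
    apply Set.Subset.antisymm
    · intro x hx
      obtain ⟨ε, hε, hmem⟩ := exists_extend_of_mem_intrinsicInterior h
        (show c ∈ ncone P (exposedFace P c) from fun p hp f hf => hf.2 p hp)
      have h1 := hmem x hx.1 g hg
      have h2 := hx.2 g hg.1
      simp only [inner_add_left, inner_smul_left, inner_sub_left, RCLike.conj_to_real] at h1
      refine mem_exposedFace_of_le hg hx.1 ?_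
      by_contra! h3
      nlinarith [mul_pos hε (sub_pos.2 h3), mul_nonneg hε.le (sub_nonneg.2 h2)]
    · intro x hx
      exact ⟨hx.1, fun z hz => hy z hz x hx⟩
  · intro h
    rw [← h] at hg ⊢
    clear h c
    rw [mem_intrinsicInterior_iff_eventually]
    refine ⟨fun p hp f hf => hf.2 p hp, ?_⟩
    obtain ⟨S, rfl⟩ := hP
    have hev : ∀ᶠ z in 𝓝 y, ∀ v ∈ S, v ∉ exposedFace (convexHull ℝ (S : Set _)) y →
        ⟪z, v⟫ < ⟪z, g⟫ := by
      rw [Filter.eventually_all_finset]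
      intro v hv
      by_cases hvG : v ∈ exposedFace (convexHull ℝ (S : Set _)) y
      · simp [hvG]
      · have hlt := inner_lt_of_notMem_exposedFace hg (subset_convexHull ℝ _ hv) hvG
        have hc1 : Continuous fun z : EuclideanSpace ℝ (Fin n) => ⟪z, v⟫ := by fun_prop
        have hc2 : Continuous fun z : EuclideanSpace ℝ (Fin n) => ⟪z, g⟫ := by fun_prop
        filter_upwards [(hc1.tendsto y).eventually_lt (hc2.tendsto y) hlt] with z hz _
        exact hz
    filter_upwards [hev] with z hz hzs
    have hconst : ∀ f ∈ exposedFace (convexHull ℝ (S : Set _)) y, ⟪z, f⟫ = ⟪z, g⟫ := by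
      intro f hf
      have := inner_eq_of_mem_affineSpan (c := f - g) (a := 0) (z := z) (fun w hw => by
        rw [real_inner_comm, inner_sub_right, sub_eq_zero]
        exact le_antisymm (hw f hf.1 g hg) (hw g hg.1 f hf)) hzs
      rwa [real_inner_comm, inner_sub_right, sub_eq_zero] at this
    intro p hp f hf
    rw [hconst f hf]
    refine inner_le_of_mem_convexHull (fun v hv => ?_) hp
    by_cases hvG : v ∈ exposedFace (convexHull ℝ (S : Set _)) y
    · exact (hconst v hvG).le
    · exact (hz v hv hvG).le

lemma PerfectlyCentered.exists_exposedFace_eq (hpc : PerfectlyCentered P) (hP : IsPolytope P)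
    {c : EuclideanSpace ℝ (Fin n)} (hne : (exposedFace P c).Nonempty) :
    ∃ p ∈ intrinsicInterior ℝ (exposedFace P c), exposedFace P p = exposedFace P c := by
  obtain ⟨p, hp, horth⟩ := hpc _ ⟨c, rfl⟩ hne
  refine ⟨p, hp, ?_⟩
  have hpF : p ∈ exposedFace P c := intrinsicInterior_subset hp
  have hconst : ∀ x ∈ exposedFace P c, ⟪p, x⟫ = ⟪p, p⟫ := by
    intro x hx
    have := horth x (subset_affineSpan ℝ _ hx)
    rwa [real_inner_comm, inner_sub_right, sub_eq_zero] at this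
  suffices h : ∀ x ∈ P, x ∉ exposedFace P c → ⟪p, x⟫ < ⟪p, p⟫ by
    have hpp : p ∈ exposedFace P p := by
      refine ⟨hpF.1, fun x hx => ?_⟩
      by_cases hxF : x ∈ exposedFace P c
      · exact (hconst x hxF).le
      · exact (h x hx hxF).le
    apply Set.Subset.antisymm
    · intro x hx
      by_contra hxF
      exact (h x hx.1 hxF).not_ge (hx.2 p hpF.1)
    · intro x hx
      exact mem_exposedFace_of_le hpp hx.1 (hconst x hx).ge
  obtain ⟨S, rfl⟩ := hP
  set P := convexHull ℝ (S : Set (EuclideanSpace ℝ (Fin n))) with hPdef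
  have hSP : ∀ v ∈ S, v ∈ P := fun v hv => subset_convexHull ℝ _ hv
  classical
  set T := S.filter (fun v => v ∉ exposedFace P c) with hT
  intro x hx hxF
  have hTne : T.Nonempty := by
    by_contra hempty
    rw [Finset.not_nonempty_iff_eq_empty, hT, Finset.filter_eq_empty_iff] at hempty
    refine hxF (convexHull_min (fun v hv => ?_) (convex_exposedFace (convex_convexHull ℝ _) c) hx)
    exact not_not.1 (hempty hv)
  obtain ⟨v₀, hv₀, hmax⟩ := T.exists_max_image (fun v => ⟪p, v - p⟫ / ⟪c, p - v⟫) hTne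
  set r := ⟪p, v₀ - p⟫ / ⟪c, p - v₀⟫ with hr
  have hpos : ∀ v ∈ P, v ∉ exposedFace P c → 0 < ⟪c, p - v⟫ := by
    intro v hv hvF
    rw [inner_sub_right]
    exact sub_pos.2 (inner_lt_of_notMem_exposedFace hpF hv hvF)
  obtain ⟨hv₀S, hv₀F⟩ := Finset.mem_filter.1 hv₀
  have hle : ∀ z ∈ P, ⟪p + r • c, z⟫ ≤ ⟪p + r • c, p⟫ := by
    intro z hz
    refine inner_le_of_mem_convexHull (fun v hv => ?_) hz
    simp only [inner_add_left, inner_smul_left, RCLike.conj_to_real]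
    by_cases hvF : v ∈ exposedFace P c
    · rw [hconst v hvF, inner_eq_of_mem_exposedFace hvF hpF]
    · have := hmax v (Finset.mem_filter.2 ⟨hv, hvF⟩)
      rw [div_le_iff₀ (hpos v (hSP v hv) hvF)] at this
      rw [inner_sub_right, inner_sub_right] at this
      linarith
  have hxpos := hpos x hx hxF
  have hxle := hle x hx
  simp only [inner_add_left, inner_smul_left, RCLike.conj_to_real] at hxle
  rw [inner_sub_right] at hxpos
  rcases lt_or_ge r 0 with hr0 | hr0
  · nlinarith
  exfalso
  have hpG : p ∈ exposedFace P (p + r • c) := ⟨hpF.1, hle⟩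
  obtain ⟨q, hq, hqorth⟩ := hpc _ ⟨p + r • c, rfl⟩ ⟨p, hpG⟩
  have hqG : q ∈ exposedFace P (p + r • c) := intrinsicInterior_subset hq
  have hqp := hqorth p (subset_affineSpan ℝ _ hpG)
  have hqe := inner_eq_of_mem_exposedFace hqG hpG
  simp only [inner_add_left, inner_smul_left, RCLike.conj_to_real] at hqe
  have hcq := hpF.2 q hqG.1
  have hpq : p = q := by
    rw [← sub_eq_zero, ← real_inner_self_nonpos]
    rw [inner_sub_left] at hqp
    simp only [inner_sub_left, inner_sub_right]
    nlinarith [mul_nonneg hr0 (sub_nonneg.2 hcq), real_inner_comm p q]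
  rw [← hpq] at hq
  have hv₀pos := hpos v₀ (hSP v₀ hv₀S) hv₀F
  have hv₀G : v₀ ∈ exposedFace P (p + r • c) := by
    refine mem_exposedFace_of_le hpG (hSP v₀ hv₀S) ?_
    have := div_mul_cancel₀ ⟪p, v₀ - p⟫ hv₀pos.ne'
    rw [← hr, inner_sub_right, inner_sub_right] at this
    simp only [inner_add_left, inner_smul_left, RCLike.conj_to_real]
    linarith
  obtain ⟨ε, hε, hmem⟩ := exists_extend_of_mem_intrinsicInterior hq hv₀G
  have := hpF.2 _ hmem.1
  rw [inner_add_right, inner_smul_right] at this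
  nlinarith [mul_pos hε hv₀pos]

lemma exists_decomposition_of_exposedFace {S : Finset (EuclideanSpace ℝ (Fin n))}
    (hPS : P = convexHull ℝ (S : Set (EuclideanSpace ℝ (Fin n))))
    (h0 : (0 : EuclideanSpace ℝ (Fin n)) ∈ interior P)
    (hface : ∀ c, (exposedFace P c).Nonempty →
      ∃ p ∈ exposedFace P c, exposedFace P p = exposedFace P c)
    (y p : EuclideanSpace ℝ (Fin n)) (hy : y ≠ 0) (hp : p ∈ exposedFace P y)
    (hpy : exposedFace P p = exposedFace P y) :
    ∃ d z : EuclideanSpace ℝ (Fin n), ∃ a b : ℝ, d ≠ 0 ∧ exposedFace P y ⊆ exposedFace P d ∧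
      z ∈ exposedFace P d ∧ 0 < a ∧ 0 ≤ b ∧ y = a • p + b • z := by
  classical
  induction hN : (S.filter (fun v => v ∉ exposedFace P y)).card using Nat.strong_induction_on
    generalizing y p with
  | _ N ih =>
  have hSP : ∀ v ∈ S, v ∈ P := fun v hv => hPS ▸ subset_convexHull ℝ _ hv
  set T := S.filter (fun v => v ∉ exposedFace P y) with hT
  have hpp : p ∈ exposedFace P p := hpy ▸ hp
  have hTne : T.Nonempty := by
    by_contra hempty
    rw [Finset.not_nonempty_iff_eq_empty, hT, Finset.filter_eq_empty_iff] at hempty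
    have h0P : (0 : EuclideanSpace ℝ (Fin n)) ∈ exposedFace P y := by
      have hsub : convexHull ℝ (S : Set (EuclideanSpace ℝ (Fin n))) ⊆ exposedFace P y :=
        convexHull_min (fun v hv => not_not.1 (hempty hv))
          (convex_exposedFace (hPS ▸ convex_convexHull ℝ _) y)
      exact hsub (hPS ▸ interior_subset h0)
    simpa using inner_pos_of_mem_exposedFace h0 hy h0P
  obtain ⟨v₀, hv₀, hmin⟩ := T.exists_min_image (fun v => ⟪y, p - v⟫ / ⟪p, p - v⟫) hTne
  set t := ⟪y, p - v₀⟫ / ⟪p, p - v₀⟫ with ht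
  obtain ⟨hv₀S, hv₀F⟩ := Finset.mem_filter.1 hv₀
  have hypos : ∀ v ∈ P, v ∉ exposedFace P y → 0 < ⟪y, p - v⟫ := by
    intro v hv hvF
    rw [inner_sub_right]
    exact sub_pos.2 (inner_lt_of_notMem_exposedFace hp hv hvF)
  have hppos : ∀ v ∈ P, v ∉ exposedFace P y → 0 < ⟪p, p - v⟫ := by
    intro v hv hvF
    rw [inner_sub_right]
    exact sub_pos.2 (inner_lt_of_notMem_exposedFace hpp hv (hpy ▸ hvF))
  have ht0 : 0 < t := div_pos (hypos _ (hSP _ hv₀S) hv₀F) (hppos _ (hSP _ hv₀S) hv₀F)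
  have hpz : p ∈ exposedFace P (y - t • p) := by
    refine ⟨hp.1, fun x hx => ?_⟩
    rw [hPS] at hx
    refine inner_le_of_mem_convexHull (fun v hv => ?_) hx
    simp only [inner_sub_left, inner_smul_left, RCLike.conj_to_real]
    by_cases hvF : v ∈ exposedFace P y
    · rw [inner_eq_of_mem_exposedFace hvF hp,
        inner_eq_of_mem_exposedFace (c := p) (hpy ▸ hvF) hpp]
    · have := hmin v (Finset.mem_filter.2 ⟨hv, hvF⟩)
      rw [le_div_iff₀ (hppos v (hSP v hv) hvF), inner_sub_right, inner_sub_right] at this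
      linarith
  have hsub : exposedFace P y ⊆ exposedFace P (y - t • p) := by
    intro x hx
    refine mem_exposedFace_of_le hpz hx.1 ?_
    simp only [inner_sub_left, inner_smul_left, RCLike.conj_to_real]
    have hxp : x ∈ exposedFace P p := hpy ▸ hx
    rw [inner_eq_of_mem_exposedFace hx hp, inner_eq_of_mem_exposedFace hxp hpp]
  have hv₀z : v₀ ∈ exposedFace P (y - t • p) := by
    refine mem_exposedFace_of_le hpz (hSP _ hv₀S) ?_
    have := div_mul_cancel₀ ⟪y, p - v₀⟫ (hppos _ (hSP _ hv₀S) hv₀F).ne'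
    rw [← ht, inner_sub_right, inner_sub_right] at this
    simp only [inner_sub_left, inner_smul_left, RCLike.conj_to_real]
    linarith
  by_cases hz : y - t • p = 0
  · exact ⟨y, p, t, 0, hy, subset_rfl, hp, ht0, le_rfl, by simpa [sub_eq_zero] using hz⟩
  obtain ⟨q, hq, hqz⟩ := hface _ ⟨p, hpz⟩
  have hcard : (S.filter (fun v => v ∉ exposedFace P (y - t • p))).card < N := by
    rw [← hN]
    apply Finset.card_lt_card
    refine Finset.ssubset_iff_of_subset (fun v hv => ?_) |>.2 ⟨v₀, hv₀, ?_⟩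
    · rw [Finset.mem_filter] at hv ⊢
      exact ⟨hv.1, fun h => hv.2 (hsub h)⟩
    · simp [hv₀z]
  obtain ⟨d, w, a, b, hd, hzd, hwd, ha, hb, heq⟩ := ih _ hcard _ q hz hq hqz rfl
  have hab : 0 < a + b := by positivity
  refine ⟨d, (a / (a + b)) • q + (b / (a + b)) • w, t, a + b, hd, hsub.trans hzd, ?_, ht0,
    hab.le, ?_⟩
  · exact convex_exposedFace (hPS ▸ convex_convexHull ℝ _) d (hzd hq) hwd (by positivity)
      (by positivity) (by field_simp)
  · rw [smul_add, smul_smul, smul_smul, mul_div_cancel₀ _ hab.ne', mul_div_cancel₀ _ hab.ne',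
      ← heq]
    module

lemma PerfectlyCentered.exposedFace_subset (hpc : PerfectlyCentered P) (hP : IsPolytope P)
    (h0 : (0 : EuclideanSpace ℝ (Fin n)) ∈ interior P) {c y : EuclideanSpace ℝ (Fin n)}
    (hyne : (exposedFace P y).Nonempty) (hy : y ∈ exposedFace P c) :
    exposedFace P y ⊆ exposedFace P c := by
  by_cases hc : c = 0
  · intro x hx
    exact ⟨hx.1, by simp [hc]⟩
  have hm := inner_pos_of_mem_exposedFace h0 hc hy
  have hy0 : y ≠ 0 := by
    rintro rfl
    simp at hm
  obtain ⟨p, hp, hpy⟩ := hpc.exists_exposedFace_eq hP hyne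
  have hpF := intrinsicInterior_subset hp
  have hpc' : p ∈ exposedFace P c := by
    obtain ⟨S, hS⟩ := hP
    obtain ⟨d, z, a, b, hd, hyd, hz, ha, hb, heq⟩ := exists_decomposition_of_exposedFace hS h0
      (fun c hc => (hpc.exists_exposedFace_eq ⟨S, hS⟩ hc).imp
        fun _ h => ⟨intrinsicInterior_subset h.1, h.2⟩) y p hy0 hpF hpy
    have hM := inner_pos_of_mem_exposedFace h0 hd hz
    have hab : a + b ≤ 1 := by
      have h1 := hz.2 y hy.1
      rw [heq, inner_add_right, inner_smul_right, inner_smul_right,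
        inner_eq_of_mem_exposedFace (hyd hpF) hz] at h1
      by_contra! h
      nlinarith
    refine mem_exposedFace_of_le hy hpF.1 ?_
    have h1 := hy.2 z hz.1
    have h2 : ⟪c, y⟫ = a * ⟪c, p⟫ + b * ⟪c, z⟫ := by
      conv_lhs => rw [heq]
      rw [inner_add_right, inner_smul_right, inner_smul_right]
    refine le_of_mul_le_mul_left ?_ ha
    nlinarith [mul_le_mul_of_nonneg_left h1 hb, mul_le_mul_of_nonneg_right hab hm.le]
  intro x hx
  obtain ⟨ε, hε, hmem⟩ := exists_extend_of_mem_intrinsicInterior hp hx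
  have h1 := hpc'.2 _ hmem.1
  rw [inner_add_right, inner_smul_right, inner_sub_right] at h1
  refine mem_exposedFace_of_le hpc' hx.1 ?_
  by_contra! h
  nlinarith [mul_pos hε (sub_pos.2 h)]

end Faces

theorem stmt_1 {n : ℕ} (P : Set (EuclideanSpace ℝ (Fin n)))
    (hP : IsPolytope P) (h0 : (0 : EuclideanSpace ℝ (Fin n)) ∈ interior P) :
    PerfectlyCentered P ↔
      ∀ G F, IsFace P G → IsFace P F → G.Nonempty → F.Nonempty →
        ((intrinsicInterior ℝ (ncone P G) ∩ intrinsicInterior ℝ F).Nonempty ↔ G ⊆ F) := by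
  constructor
  · rintro hpc _ _ ⟨d, rfl⟩ ⟨c, rfl⟩ hG hF
    change (intrinsicInterior ℝ (ncone P (exposedFace P d)) ∩
      intrinsicInterior ℝ (exposedFace P c)).Nonempty ↔ exposedFace P d ⊆ exposedFace P c
    constructor
    · rintro ⟨y, hyN, hyF⟩
      have h := (mem_intrinsicInterior_ncone_iff hP hG).1 hyN
      rw [← h]
      exact hpc.exposedFace_subset hP h0 (by rw [h]; exact hG) (intrinsicInterior_subset hyF)
    · intro hGF
      obtain ⟨p, hp, hpd⟩ := hpc.exists_exposedFace_eq hP hG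
      obtain ⟨q, hq, hqc⟩ := hpc.exists_exposedFace_eq hP hF
      have hconv : Convex ℝ P := by
        obtain ⟨S, rfl⟩ := hP
        exact convex_convexHull ℝ _
      have hpG := intrinsicInterior_subset hp
      have hpp : p ∈ exposedFace P p := hpd ▸ hpG
      have hsub : exposedFace P p ⊆ exposedFace P q := by rwa [hpd, hqc]
      refine ⟨(1 / 2 : ℝ) • q + (1 / 2 : ℝ) • p, ?_, combo_mem_intrinsicInterior
        (convex_exposedFace hconv c) hq (hGF hpG) (by norm_num) (by norm_num) (by norm_num)⟩
      rw [mem_intrinsicInterior_ncone_iff hP hG, ← hpd]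
      ext x
      constructor
      · intro hx
        have h1 := hx.2 p hpG.1
        have h2 := (hsub hpp).2 x hx.1
        simp only [inner_add_left, inner_smul_left, RCLike.conj_to_real] at h1
        exact mem_exposedFace_of_le hpp hx.1 (by linarith)
      · intro hx
        refine ⟨hx.1, fun z hz => ?_⟩
        have h1 := hx.2 z hz
        have h2 := (hsub hx).2 z hz
        simp only [inner_add_left, inner_smul_left, RCLike.conj_to_real]
        linarith
  · intro h F hF hne
    obtain ⟨p, hpN, hpF⟩ := (h F F hF hF hne hne).2 subset_rfl
    refine ⟨p, hpF, fun x hx => ?_⟩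
    have hN := intrinsicInterior_subset hpN
    have hFP : F ⊆ P := by
      obtain ⟨c, rfl⟩ := hF
      exact fun x hx => hx.1
    have hpm := intrinsicInterior_subset hpF
    rw [real_inner_comm, inner_sub_right, sub_eq_zero]
    exact inner_eq_of_mem_affineSpan
      (fun z hz => le_antisymm (hN z (hFP hz) p hpm) (hN p (hFP hpm) z hz)) hx
end

section
/- Let P ⊆ ℝ³ be a polytope with 0 in its interior which is midscribed: every edge of P (face whose affine span has dimension 1) contains a point of the unit sphere and contains no point of the open unit ball, and no extreme point of P lies on the unit sphere. Then P is perfectly centered. -/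
open RealInnerProductSpace

open Module

section Support

variable {E : Type*} [NormedAddCommGroup E] [InnerProductSpace ℝ E]

/-- A functional that is constant on `F` vanishes on the direction of the affine span of `F`. -/
theorem inner_eq_zero_of_mem_direction {F : Set E} {q g : E} (hq : q ∈ F)
    (h : ∀ x ∈ F, ⟪g, x - q⟫ = 0) {v : E} (hv : v ∈ (affineSpan ℝ F).direction) :
    ⟪g, v⟫ = 0 := by
  rw [direction_affineSpan, vectorSpan_eq_span_vsub_set_right ℝ hq] at hv
  induction hv using Submodule.span_induction with
  | mem x hx =>
    obtain ⟨y, hy, rfl⟩ := hx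
    exact h y hy
  | zero => exact inner_zero_right g
  | add x y _ _ hx hy => rw [inner_add_right, hx, hy, add_zero]
  | smul a x _ hx => rw [inner_smul_right, hx, mul_zero]

theorem sub_mem_direction_affineSpan {F : Set E} {x y : E} (hx : x ∈ F) (hy : y ∈ F) :
    x - y ∈ (affineSpan ℝ F).direction :=
  AffineSubspace.vsub_mem_direction (subset_affineSpan ℝ F hx) (subset_affineSpan ℝ F hy)

/-- `g` properly supports `F` at `w`: it attains its maximum over `F` at `w` and is not constant
on `F`. -/
def ProperlySupports (F : Set E) (g w : E) : Prop :=
  (∀ x ∈ F, ⟪g, x - w⟫ ≤ 0) ∧ ∃ x ∈ F, ⟪g, x - w⟫ < 0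

/-- A point of a convex set outside its relative interior has a proper supporting functional. -/
theorem exists_properlySupports_of_notMem_intrinsicInterior [FiniteDimensional ℝ E] {F : Set E}
    (hF : Convex ℝ F) {q : E} (hq : q ∈ F) (hqi : q ∉ intrinsicInterior ℝ F) :
    ∃ g, ProperlySupports F g q := by
  have : Nonempty F := ⟨⟨q, hq⟩⟩
  let q' : affineSpan ℝ F := ⟨q, subset_affineSpan ℝ F hq⟩
  let φ : (affineSpan ℝ F).direction ≃ₜ affineSpan ℝ F := Homeomorph.vaddConst q'
  let A : Set (affineSpan ℝ F).direction := φ ⁻¹' ((↑) ⁻¹' F)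
  have hφ (v : (affineSpan ℝ F).direction) : ((φ v : affineSpan ℝ F) : E) = v + q := rfl
  have hAconv : Convex ℝ A := by
    intro x hx y hy a b ha hb hab
    have h := hF hx hy ha hb hab
    change ((φ (a • x + b • y) : affineSpan ℝ F) : E) ∈ F
    convert h using 1
    rw [hφ, hφ, hφ]
    push_cast
    calc (a • (x : E) + b • (y : E)) + q = (a • (x : E) + b • (y : E)) + (a + b) • q := by
          rw [hab, one_smul]
      _ = _ := by module
  have hAint : (interior A).Nonempty := by
    obtain ⟨x, y, hy, -⟩ := Set.Nonempty.intrinsicInterior hF ⟨q, hq⟩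
    refine ⟨φ.symm y, ?_⟩
    rw [← φ.preimage_interior]
    simpa using hy
  have h0A : (0 : (affineSpan ℝ F).direction) ∉ interior A := by
    intro h
    rw [← φ.preimage_interior] at h
    exact hqi ⟨φ 0, h, by simp [hφ]⟩
  obtain ⟨f, hf0, hf⟩ := geometric_hahn_banach_of_nonempty_interior_point hAconv h0A hAint
  let g := (InnerProductSpace.toDual ℝ (affineSpan ℝ F).direction).symm f
  have hg (v : (affineSpan ℝ F).direction) : ⟪(g : E), v⟫ = f v := by
    rw [← Submodule.coe_inner]
    exact InnerProductSpace.toDual_symm_apply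
  have hle : ∀ x ∈ F, ⟪(g : E), x - q⟫ ≤ 0 := by
    intro x hx
    have h := hf ⟨x - q, sub_mem_direction_affineSpan hx hq⟩ (by simpa [A, hφ] using hx)
    rwa [map_zero, ← hg] at h
  refine ⟨g, hle, ?_⟩
  by_contra! hge
  have hz := inner_eq_zero_of_mem_direction hq
    (fun x hx => le_antisymm (hle x hx) (hge x hx)) g.2
  refine hf0 (ContinuousLinearMap.ext fun v => ?_)
  rw [← hg, inner_self_eq_zero.mp hz, inner_zero_left]
  rfl

/-- A nonempty compact convex set has a point at which the norm is minimal. -/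
theorem exists_inner_sub_nonneg {F : Set E} (hne : F.Nonempty) (hc : IsCompact F)
    (hF : Convex ℝ F) : ∃ q ∈ F, ∀ x ∈ F, 0 ≤ ⟪x - q, q⟫ := by
  obtain ⟨q, hq, h⟩ := exists_norm_eq_iInf_of_complete_convex hne hc.isComplete hF 0
  refine ⟨q, hq, fun x hx => ?_⟩
  have := (norm_eq_iInf_iff_real_inner_le_zero hF hq).1 h x hx
  rw [zero_sub, inner_neg_left, real_inner_comm] at this
  linarith

theorem norm_sq_add_norm_sub_sq_le {q x : E} (h : 0 ≤ ⟪x - q, q⟫) :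
    ‖q‖ ^ 2 + ‖x - q‖ ^ 2 ≤ ‖x‖ ^ 2 := by
  have := norm_add_sq_real (x - q) q
  rw [sub_add_cancel] at this
  linarith

/-- On a collinear set, a functional with a maximum at an inner point of a segment
is constant. -/
theorem inner_eq_zero_of_openSegment {F : Set E}
    (hdim : finrank ℝ (affineSpan ℝ F).direction = 1) {g t x y : E} (hx : x ∈ F) (hy : y ∈ F)
    (hne : x ≠ t) (ht : t ∈ F) (hts : t ∈ openSegment ℝ x y)
    (hg : ∀ z ∈ F, ⟪g, z - t⟫ ≤ 0) : ∀ z ∈ F, ⟪g, z - t⟫ = 0 := by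
  have hgx : ⟪g, x - t⟫ = 0 := by
    obtain ⟨a, b, ha, hb, hab, rfl⟩ := hts
    set t := a • x + b • y with htdef
    have h : a • (x - t) + b • (y - t) = 0 := by
      calc a • (x - t) + b • (y - t) = a • x + b • y - (a + b) • t := by module
        _ = 0 := by rw [hab, one_smul, sub_self]
    have h' := congrArg (fun v => ⟪g, v⟫) h
    simp only [inner_add_right, inner_smul_right, inner_zero_right] at h'
    nlinarith [hg x hx, hg y hy, mul_nonneg hb.le (neg_nonneg.2 (hg y hy))]
  intro z hz
  obtain ⟨c, hc⟩ := (finrank_eq_one_iff_of_nonzero'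
    (⟨x - t, sub_mem_direction_affineSpan hx ht⟩ : (affineSpan ℝ F).direction)
    (by simpa [Subtype.ext_iff, sub_eq_zero] using hne)).1 hdim
    ⟨z - t, sub_mem_direction_affineSpan hz ht⟩
  have hc' : c • (x - t) = z - t := congrArg Subtype.val hc
  rw [← hc', inner_smul_right, hgx, mul_zero]

end Support

section Faces

variable {n : ℕ} {P F : Set (EuclideanSpace ℝ (Fin n))}

theorem IsFace.subset (hF : IsFace P F) : F ⊆ P := by
  obtain ⟨c, rfl⟩ := hF
  exact fun x hx => hx.1

theorem IsPolytope.convex (hP : IsPolytope P) : Convex ℝ P := by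
  obtain ⟨S, rfl⟩ := hP
  exact convex_convexHull ℝ _

theorem IsPolytope.isCompact (hP : IsPolytope P) : IsCompact P := by
  obtain ⟨S, rfl⟩ := hP
  exact S.finite_toSet.isCompact_convexHull (𝕜 := ℝ)

/-- A face is cut out of `P` by the value of a functional at any of its points. -/
theorem mem_face_iff {c w x : EuclideanSpace ℝ (Fin n)}
    (hw : w ∈ {x ∈ P | ∀ y ∈ P, ⟪c, y⟫ ≤ ⟪c, x⟫}) :
    x ∈ {x ∈ P | ∀ y ∈ P, ⟪c, y⟫ ≤ ⟪c, x⟫} ↔ x ∈ P ∧ ⟪c, x - w⟫ = 0 := by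
  rw [inner_sub_right, sub_eq_zero]
  exact ⟨fun hx => ⟨hx.1, le_antisymm (hw.2 x hx.1) (hx.2 w hw.1)⟩,
    fun hx => ⟨hx.1, fun y hy => (hw.2 y hy).trans hx.2.ge⟩⟩

theorem IsFace.convex (hF : IsFace P F) (hP : Convex ℝ P) : Convex ℝ F := by
  obtain ⟨c, rfl⟩ := hF
  intro x hx y hy a b ha hb hab
  refine ⟨hP hx.1 hy.1 ha hb hab, fun z hz => ?_⟩
  rw [inner_add_right, inner_smul_right, inner_smul_right]
  calc ⟪c, z⟫ = a * ⟪c, z⟫ + b * ⟪c, z⟫ := by rw [← add_mul, hab, one_mul]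
    _ ≤ _ := add_le_add (mul_le_mul_of_nonneg_left (hx.2 z hz) ha)
      (mul_le_mul_of_nonneg_left (hy.2 z hz) hb)

theorem IsFace.isCompact (hF : IsFace P F) (hP : IsCompact P) : IsCompact F := by
  obtain ⟨c, rfl⟩ := hF
  have : {x ∈ P | ∀ y ∈ P, ⟪c, y⟫ ≤ ⟪c, x⟫} = P ∩ ⋂ y ∈ P, {x | ⟪c, y⟫ ≤ ⟪c, x⟫} := by
    ext x; simp
  rw [this]
  exact hP.inter_right (isClosed_biInter fun y _ => isClosed_le (by fun_prop) (by fun_prop))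

/-- A face contains every segment of `P` that it meets in an inner point. -/
theorem IsFace.left_mem_of_mem_openSegment (hF : IsFace P F) {t x y : EuclideanSpace ℝ (Fin n)}
    (ht : t ∈ F) (hx : x ∈ P) (hy : y ∈ P) (hts : t ∈ openSegment ℝ x y) : x ∈ F := by
  obtain ⟨c, rfl⟩ := hF
  refine ⟨hx, fun z hz => (ht.2 z hz).trans ?_⟩
  have hyt := ht.2 y hy
  obtain ⟨a, b, ha, hb, hab, rfl⟩ := hts
  simp only [inner_add_right, inner_smul_right] at hyt ⊢
  obtain rfl : a = 1 - b := by linarith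
  have h1 : ⟪c, y⟫ ≤ ⟪c, x⟫ := by
    by_contra! h
    nlinarith
  nlinarith

/-- Cutting a face of the polytope generated by `S` further: a functional that, among the
generators in `F`, is maximal at `w ∈ F` is maximal over `F` at `w`, and defines a face of the
polytope. -/
theorem isFace_of_generators {S : Finset (EuclideanSpace ℝ (Fin n))}
    (hF : IsFace (convexHull ℝ (S : Set (EuclideanSpace ℝ (Fin n)))) F)
    {w g : EuclideanSpace ℝ (Fin n)} (hw : w ∈ F)
    (hg : ∀ s ∈ S, s ∈ F → ⟪g, s - w⟫ ≤ 0) :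
    (∀ x ∈ F, ⟪g, x - w⟫ ≤ 0) ∧
      IsFace (convexHull ℝ (S : Set (EuclideanSpace ℝ (Fin n)))) {x ∈ F | ⟪g, x - w⟫ = 0} := by
  obtain ⟨c, rfl⟩ := hF
  set P := convexHull ℝ (S : Set (EuclideanSpace ℝ (Fin n))) with hPdef
  have hSP : ∀ s ∈ S, s ∈ P := fun s hs => subset_convexHull ℝ _ hs
  have hcP : ∀ x ∈ P, ⟪c, x - w⟫ ≤ 0 := fun x hx => by
    rw [inner_sub_right]; linarith [hw.2 x hx]
  have hN : ∀ᶠ N : ℝ in Filter.atTop, ∀ s ∈ S, ⟪N • c + g, s - w⟫ ≤ 0 := by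
    refine (Filter.eventually_all_finset S).2 fun s hs => ?_
    simp only [inner_add_left, real_inner_smul_left]
    rcases (hcP s (hSP s hs)).lt_or_eq with h | h
    · filter_upwards [Filter.eventually_ge_atTop (⟪g, s - w⟫ / -⟪c, s - w⟫)] with N hN
      rw [div_le_iff₀ (by linarith)] at hN
      linarith
    · filter_upwards with N
      rw [h, mul_zero, zero_add]
      exact hg s hs ((mem_face_iff hw).2 ⟨hSP s hs, h⟩)
  obtain ⟨N, hN⟩ := hN.exists
  have hNP : ∀ x ∈ P, ⟪N • c + g, x - w⟫ ≤ 0 := by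
    intro x hx
    have hconv : Convex ℝ {x | ⟪N • c + g, x⟫ ≤ ⟪N • c + g, w⟫} :=
      convex_halfSpace_le (innerₗ _ (N • c + g)).isLinear _
    have := convexHull_min (fun s hs => by
      have := hN s hs
      rw [inner_sub_right] at this
      simpa using this) hconv hx
    rw [inner_sub_right]
    simpa using this
  simp only [inner_add_left, real_inner_smul_left] at hNP
  have hgF : ∀ x ∈ P, ⟪c, x - w⟫ = 0 → ⟪g, x - w⟫ ≤ 0 := fun x hx h => by
    have := hNP x hx
    rwa [h, mul_zero, zero_add] at this
  refine ⟨fun x hx => hgF x hx.1 ((mem_face_iff hw).1 hx).2, (N + 1) • c + g, ?_⟩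
  have hw' : w ∈ {x ∈ P | ∀ y ∈ P, ⟪(N + 1) • c + g, y⟫ ≤ ⟪(N + 1) • c + g, x⟫} := by
    refine ⟨hw.1, fun y hy => ?_⟩
    rw [← sub_nonpos, ← inner_sub_right, inner_add_left, real_inner_smul_left]
    linarith [hNP y hy, hcP y hy]
  ext x
  rw [mem_face_iff hw', Set.mem_ofPred_eq, mem_face_iff hw, inner_add_left, real_inner_smul_left]
  constructor
  · rintro ⟨⟨hx, h1⟩, h2⟩
    exact ⟨hx, by rw [h1, h2]; ring⟩
  · rintro ⟨hx, h⟩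
    have h1 : ⟪c, x - w⟫ = 0 := by linarith [hNP x hx, hcP x hx]
    exact ⟨⟨hx, h1⟩, by rw [h1] at h; linarith⟩

/-- A generator other than `w` at which `g` is maximal over a two-dimensional face `F` yields
an edge through `w`. -/
theorem exists_edge_of_properlySupports_of_generator {S : Finset (EuclideanSpace ℝ (Fin n))}
    (hF : IsFace (convexHull ℝ (S : Set (EuclideanSpace ℝ (Fin n)))) F)
    (hdim : finrank ℝ (affineSpan ℝ F).direction = 2)
    {w g s : EuclideanSpace ℝ (Fin n)} (hw : w ∈ F) (hg : ∀ s ∈ S, s ∈ F → ⟪g, s - w⟫ ≤ 0)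
    (hg' : ∃ v ∈ (affineSpan ℝ F).direction, ⟪g, v⟫ ≠ 0)
    (hs : s ∈ F) (hsw : s ≠ w) (hgs : ⟪g, s - w⟫ = 0) :
    ∃ G ⊆ F, w ∈ G ∧ IsFace (convexHull ℝ (S : Set (EuclideanSpace ℝ (Fin n)))) G ∧
      finrank ℝ (affineSpan ℝ G).direction = 1 := by
  set G := {x ∈ F | ⟪g, x - w⟫ = 0} with hG
  have hGF : G ⊆ F := fun x hx => hx.1
  have hwG : w ∈ G := ⟨hw, by rw [sub_self, inner_zero_right]⟩
  have hsG : s ∈ G := ⟨hs, hgs⟩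
  refine ⟨G, hGF, hwG, (isFace_of_generators hF hw hg).2, ?_⟩
  have hlt : (affineSpan ℝ G).direction < (affineSpan ℝ F).direction := by
    refine lt_of_le_of_ne (AffineSubspace.direction_le (affineSpan_mono ℝ hGF)) fun h => ?_
    obtain ⟨v, hv, hgv⟩ := hg'
    rw [← h] at hv
    exact hgv (inner_eq_zero_of_mem_direction hwG (fun x hx => hx.2) hv)
  have h1 := Submodule.finrank_lt_finrank_of_lt hlt
  have h2 : 0 < finrank ℝ (affineSpan ℝ G).direction :=
    Module.finrank_pos_iff_exists_ne_zero.2 ⟨⟨s - w, sub_mem_direction_affineSpan hsG hwG⟩,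
      by simpa [Subtype.ext_iff, sub_eq_zero] using hsw⟩
  omega

/-- Every relative boundary point of a two-dimensional face lies on an edge of that face. -/
theorem exists_edge_of_properlySupports (hP : IsPolytope P) (hF : IsFace P F)
    (hdim : finrank ℝ (affineSpan ℝ F).direction = 2)
    {w g : EuclideanSpace ℝ (Fin n)} (hw : w ∈ F) (hg : ProperlySupports F g w) :
    ∃ G ⊆ F, w ∈ G ∧ IsFace P G ∧ finrank ℝ (affineSpan ℝ G).direction = 1 := by
  obtain ⟨S, rfl⟩ := hP
  obtain ⟨hg, x, hx, hgx⟩ := hg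
  have hgV : ∃ v ∈ (affineSpan ℝ F).direction, ⟪g, v⟫ ≠ 0 :=
    ⟨x - w, sub_mem_direction_affineSpan hx hw, hgx.ne⟩
  by_cases hs : ∃ s ∈ S, s ∈ F ∧ s ≠ w ∧ ⟪g, s - w⟫ = 0
  · obtain ⟨s, -, hsF, hsw, hgs⟩ := hs
    exact exists_edge_of_properlySupports_of_generator hF hdim hw
      (fun s _ hs => hg s hs) hgV hsF hsw hgs
  · push Not at hs
    replace hs : ∀ s ∈ S, s ∈ F → s ≠ w → ⟪g, s - w⟫ < 0 := fun s hsS hsF hsw =>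
      lt_of_le_of_ne (hg s hsF) (hs s hsS hsF hsw)
    classical
    let T := S.filter fun s => s ∈ F ∧ s ≠ w
    have hT : T.Nonempty := by
      by_contra hT
      have hSw : ∀ s ∈ S, s ∈ F → s = w := by
        intro s hsS hsF
        by_contra hsw
        exact hT ⟨s, by simp [T, hsS, hsF, hsw]⟩
      have := (isFace_of_generators (g := -g) hF hw fun s hsS hsF => by
        rw [hSw s hsS hsF, sub_self, inner_zero_right]).1 x hx
      rw [inner_neg_left] at this
      linarith
    -- a direction in the plane of `F` orthogonal to `g`
    obtain ⟨d, hdV, hgd, hd0⟩ : ∃ d ∈ (affineSpan ℝ F).direction, ⟪g, d⟫ = 0 ∧ d ≠ 0 := by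
      let f : (affineSpan ℝ F).direction →ₗ[ℝ] ℝ :=
        (innerₗ _ g).comp (affineSpan ℝ F).direction.subtype
      obtain ⟨d, hd, hd0⟩ := f.ker.exists_mem_ne_zero_of_ne_bot
        (LinearMap.ker_ne_bot_of_finrank_lt (by rw [hdim]; simp))
      exact ⟨d, d.2, hd, by simpa using hd0⟩
    obtain ⟨s, hsT, hmax⟩ := T.exists_max_image (fun s => ⟪d, s - w⟫ / -⟪g, s - w⟫) hT
    simp only [T, Finset.mem_filter] at hsT hmax
    obtain ⟨hsS, hsF, hsw⟩ := hsT
    set μ := ⟪d, s - w⟫ / -⟪g, s - w⟫ with hμ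
    have hgs := hs s hsS hsF hsw
    refine exists_edge_of_properlySupports_of_generator (g := d + μ • g) hF hdim hw ?_
      ⟨d, hdV, ?_⟩ hsF hsw ?_
    · intro r hrS hrF
      by_cases hrw : r = w
      · rw [hrw, sub_self, inner_zero_right]
      · have h := hmax r ⟨hrS, hrF, hrw⟩
        rw [div_le_iff₀ (by linarith [hs r hrS hrF hrw])] at h
        rw [inner_add_left, real_inner_smul_left]
        linarith
    · rw [inner_add_left, real_inner_smul_left, hgd, mul_zero, add_zero]
      exact inner_self_ne_zero.2 hd0
    · rw [inner_add_left, real_inner_smul_left, hμ]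
      field_simp [hgs.ne]
      ring

/-- A functional that is maximal over an edge at a non-extreme point of the polytope is constant
on that edge. -/
theorem inner_eq_zero_of_edge {G : Set (EuclideanSpace ℝ (Fin n))} (hG : IsFace P G)
    (hdim : finrank ℝ (affineSpan ℝ G).direction = 1) {g t : EuclideanSpace ℝ (Fin n)}
    (ht : t ∈ G) (hext : t ∉ Set.extremePoints ℝ P) (hg : ∀ z ∈ G, ⟪g, z - t⟫ ≤ 0) :
    ∀ z ∈ G, ⟪g, z - t⟫ = 0 := by
  rw [mem_extremePoints_iff_left] at hext
  push Not at hext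
  obtain ⟨x, hx, y, hy, hts, hxt⟩ := hext (hG.subset ht)
  exact inner_eq_zero_of_openSegment hdim (hG.left_mem_of_mem_openSegment ht hx hy hts)
    (hG.left_mem_of_mem_openSegment ht hy hx (openSegment_symm ℝ x y ▸ hts)) hxt ht hts hg

end Faces

theorem stmt_2 (P : Set (EuclideanSpace ℝ (Fin 3)))
    (hP : IsPolytope P) (h0 : (0 : EuclideanSpace ℝ (Fin 3)) ∈ interior P)
    (hedge : ∀ F, IsFace P F → Module.finrank ℝ (affineSpan ℝ F).direction = 1 →
      (F ∩ Metric.sphere (0 : EuclideanSpace ℝ (Fin 3)) 1).Nonempty ∧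
      F ∩ Metric.ball (0 : EuclideanSpace ℝ (Fin 3)) 1 = ∅)
    (hvert : ∀ v ∈ Set.extremePoints ℝ P, v ∉ Metric.sphere (0 : EuclideanSpace ℝ (Fin 3)) 1) :
    PerfectlyCentered P := by
  intro F hF hne
  have hFconv := hF.convex hP.convex
  have hFcomp := hF.isCompact hP.isCompact
  obtain ⟨c, hFc⟩ := id hF
  by_cases hc : c = 0
  · obtain rfl : F = P := by simp [hFc, hc]
    exact ⟨0, interior_subset_intrinsicInterior h0, fun x _ => inner_zero_right _⟩
  have hball : ∀ G, IsFace P G → finrank ℝ (affineSpan ℝ G).direction = 1 →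
      ∀ x ∈ G, 1 ≤ ‖x‖ := by
    intro G hG hdim x hx
    by_contra! h
    have hmem : x ∈ G ∩ Metric.ball 0 1 := ⟨hx, by simpa using h⟩
    rw [(hedge G hG hdim).2] at hmem
    exact hmem
  obtain ⟨q, hq, hmin⟩ := exists_inner_sub_nonneg hne hFcomp hFconv
  have hle : ∀ x ∈ F, ‖q‖ ≤ ‖x‖ := fun x hx => by
    have := norm_sq_add_norm_sub_sq_le (hmin x hx)
    exact le_of_sq_le_sq (by nlinarith [sq_nonneg ‖x - q‖]) (norm_nonneg x)
  have huniq : ∀ x ∈ F, ‖x‖ = ‖q‖ → x = q := fun x hx h => by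
    have := norm_sq_add_norm_sub_sq_le (hmin x hx)
    rw [h] at this
    have h' : ‖x - q‖ = 0 := by nlinarith [norm_nonneg (x - q)]
    rwa [norm_sub_eq_zero_iff] at h'
  have hVc : ∀ v ∈ (affineSpan ℝ F).direction, ⟪c, v⟫ = 0 := fun v hv => by
    subst hFc
    exact inner_eq_zero_of_mem_direction hq (fun x hx => ((mem_face_iff hq).1 hx).2) hv
  have hdim : finrank ℝ (affineSpan ℝ F).direction < 3 := by
    have hlt : (affineSpan ℝ F).direction < ⊤ := by
      refine lt_top_iff_ne_top.2 fun h => hc ?_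
      exact inner_self_eq_zero.1 (hVc c (h ▸ Submodule.mem_top))
    simpa using Submodule.finrank_lt hlt.ne
  -- if `‖q‖ = 1`, every edge in `F` touches the sphere at `q`
  have htouch : ‖q‖ = 1 → ∀ G ⊆ F, IsFace P G → finrank ℝ (affineSpan ℝ G).direction = 1 →
      q ∈ G := by
    intro hq1 G hGF hG hGdim
    obtain ⟨t, htG, ht⟩ := (hedge G hG hGdim).1
    rw [← huniq t (hGF htG) (by rw [hq1]; simpa using ht)]
    exact htG
  have hnorm : ∀ G ⊆ F, q ∈ G → IsFace P G → finrank ℝ (affineSpan ℝ G).direction = 1 →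
      ‖q‖ = 1 := by
    intro G hGF hqG hG hGdim
    obtain ⟨t, htG, ht⟩ := (hedge G hG hGdim).1
    exact le_antisymm ((hle t (hGF htG)).trans_eq (by simpa using ht)) (hball G hG hGdim q hqG)
  have key : ∀ g, ¬ ProperlySupports F g q := by
    intro g hg
    obtain ⟨x, hx, hgx⟩ := hg.2
    obtain hd | hd | hd : finrank ℝ (affineSpan ℝ F).direction = 0 ∨
        finrank ℝ (affineSpan ℝ F).direction = 1 ∨
        finrank ℝ (affineSpan ℝ F).direction = 2 := by omega
    · have h := sub_mem_direction_affineSpan hx hq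
      rw [Submodule.finrank_eq_zero.1 hd, Submodule.mem_bot] at h
      rw [h, inner_zero_right] at hgx
      exact hgx.false
    · have hq1 := hnorm F subset_rfl hq hF hd
      exact hgx.ne (inner_eq_zero_of_edge hF hd hq (fun h => hvert q h (by simpa using hq1))
        hg.1 x hx)
    · obtain ⟨G, hGF, hqG, hG, hGdim⟩ := exists_edge_of_properlySupports hP hF hd hq hg
      have hq1 := hnorm G hGF hqG hG hGdim
      obtain ⟨w, hw, hwmin⟩ := hFcomp.exists_isMinOn (f := fun y => ⟪g, y⟫) hne (by fun_prop)
      have hwq : ⟪g, w - q⟫ < 0 := by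
        have := hwmin hx
        simp only [Set.mem_ofPred_eq] at this
        rw [inner_sub_right] at hgx ⊢
        linarith
      have hsupp : ProperlySupports F (-g) w := by
        refine ⟨fun y hy => ?_, q, hq, ?_⟩
        · have := hwmin hy
          simp only [Set.mem_ofPred_eq] at this
          rw [inner_neg_left, inner_sub_right]
          linarith
        · rw [inner_neg_left, ← inner_neg_right, neg_sub]
          exact hwq
      obtain ⟨H, hHF, hwH, hH, hHdim⟩ := exists_edge_of_properlySupports hP hF hd hw hsupp
      exact hwq.ne (inner_eq_zero_of_edge hH hHdim (htouch hq1 H hHF hH hHdim)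
        (fun h => hvert q h (by simpa using hq1)) (fun z hz => hg.1 z (hHF hz)) w hwH)
  have hconst : ∀ x ∈ F, ⟪q, x - q⟫ = 0 := by
    intro x hx
    by_contra h
    refine key (-q) ⟨fun y hy => ?_, x, hx, ?_⟩
    · rw [inner_neg_left, real_inner_comm]
      linarith [hmin y hy]
    · have := hmin x hx
      rw [real_inner_comm] at this
      rw [inner_neg_left, neg_lt_zero]
      exact lt_of_le_of_ne this (Ne.symm h)
  refine ⟨q, ?_, fun x hx => ?_⟩
  · by_contra hqi
    obtain ⟨g, hg⟩ := exists_properlySupports_of_notMem_intrinsicInterior hFconv hq hqi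
    exact key g hg
  · rw [real_inner_comm]
    exact inner_eq_zero_of_mem_direction hq hconst
      (AffineSubspace.vsub_mem_direction hx (subset_affineSpan ℝ F hq))
end

section
/- Let d ≥ 2, let a ∈ ℝ^d and β ∈ ℝ, and let H = {x ∈ ℝ^d : ⟨a, x⟩ ≤ β} be a closed half-space such that: (i) the unit cube [0,1]^d is not contained in H; (ii) H intersects every facet {x ∈ [0,1]^d : x_i = ε} of the cube (for each i ∈ {1,…,d} and ε ∈ {0,1}); and (iii) ⟨a, v⟩ ≠ β for every vertex v ∈ {0,1}^d of the cube. Then the polytope Q = [0,1]^d ∩ H has at least d distinct extreme points p₁, …, p_d lying on the hyperplane {x : ⟨a, x⟩ = β}, such that each p_k is an extreme point of some face W of Q whose affine span has dimension 2 and which has exactly 5 extreme points (a pentagonal face). -/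
open RealInnerProductSpace

/-- The unit `d`-cube `[0,1]^d`. -/
def unitCube (d : ℕ) : Set (EuclideanSpace ℝ (Fin d)) :=
  {x | ∀ i, 0 ≤ x i ∧ x i ≤ 1}

section Convexity

theorem eq_zero_of_add_mem_of_sub_mem {E : Type*} [AddCommGroup E] [Module ℝ E] {s : Set E}
    {x v : E} (hx : x ∈ s.extremePoints ℝ) (hadd : x + v ∈ s) (hsub : x - v ∈ s) : v = 0 := by
  have h : x + v = x := by
    refine hx.2 hadd hsub ⟨1 / 2, 1 / 2, by norm_num, by norm_num, by norm_num, ?_⟩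
    module
  simpa using h

theorem AffineMap.image_extremePoints_of_injective {E F : Type*} [AddCommGroup E] [Module ℝ E]
    [AddCommGroup F] [Module ℝ F] (f : E →ᵃ[ℝ] F) (hf : Function.Injective f) (s : Set E) :
    (f '' s).extremePoints ℝ = f '' s.extremePoints ℝ := by
  ext x
  simp only [Set.extremePoints, Set.mem_ofPred_eq, Set.mem_image]
  constructor
  · rintro ⟨⟨y, hy, rfl⟩, h⟩
    refine ⟨y, ⟨hy, fun x₁ h₁ x₂ h₂ hseg => hf (h ⟨x₁, h₁, rfl⟩ ⟨x₂, h₂, rfl⟩ ?_)⟩, rfl⟩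
    rw [← image_openSegment]
    exact ⟨y, hseg, rfl⟩
  · rintro ⟨y, ⟨hy, h⟩, rfl⟩
    refine ⟨⟨y, hy, rfl⟩, ?_⟩
    rintro _ ⟨x₁, h₁, rfl⟩ _ ⟨x₂, h₂, rfl⟩ hseg
    rw [← image_openSegment, hf.mem_set_image] at hseg
    rw [h h₁ h₂ hseg]

theorem eq_of_convex_combination_eq_of_le {a b y z m : ℝ} (ha : 0 < a) (hb : 0 < b)
    (hab : a + b = 1) (hy : m ≤ y) (hz : m ≤ z) (h : a * y + b * z = m) : y = m := by
  obtain rfl : b = 1 - a := by linarith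
  nlinarith [mul_nonneg hb.le (sub_nonneg.2 hz), mul_nonneg ha.le (sub_nonneg.2 hy)]

theorem eq_of_convex_combination_eq_of_ge {a b y z m : ℝ} (ha : 0 < a) (hb : 0 < b)
    (hab : a + b = 1) (hy : y ≤ m) (hz : z ≤ m) (h : a * y + b * z = m) : y = m := by
  have := eq_of_convex_combination_eq_of_le ha hb hab (neg_le_neg hy) (neg_le_neg hz)
    (by linarith)
  linarith

end Convexity

section Pentagon

/-- The unit square with the corner at the origin cut off by the line `A * s + B * t = C`. -/
def cutSquare (A B C : ℝ) : Set (ℝ × ℝ) :=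
  {x | 0 ≤ x.1 ∧ x.1 ≤ 1 ∧ 0 ≤ x.2 ∧ x.2 ≤ 1 ∧ C ≤ A * x.1 + B * x.2}

variable {A B C : ℝ}

theorem swap_mem_cutSquare {x : ℝ × ℝ} : x.swap ∈ cutSquare B A C ↔ x ∈ cutSquare A B C := by
  simp only [cutSquare, Set.mem_ofPred_eq, Prod.fst_swap, Prod.snd_swap,
    add_comm (B * x.2) (A * x.1)]
  tauto

theorem swap_mem_extremePoints_cutSquare {x : ℝ × ℝ} (hx : x ∈ (cutSquare A B C).extremePoints ℝ) :
    x.swap ∈ (cutSquare B A C).extremePoints ℝ := by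
  refine ⟨swap_mem_cutSquare.2 hx.1, fun y hy z hz h => ?_⟩
  obtain ⟨a, b, ha, hb, hab, h⟩ := h
  have := hx.2 (swap_mem_cutSquare.2 hy) (swap_mem_cutSquare.2 hz)
    ⟨a, b, ha, hb, hab, by rw [← x.swap_swap, ← h]; simp⟩
  rw [← this, Prod.swap_swap]

theorem fst_mem_of_extremePoint_cutSquare (hC : 0 < C) (hA : C < A) (hB : C < B) {s t : ℝ}
    (hx : (s, t) ∈ (cutSquare A B C).extremePoints ℝ) (ht : t = 0 ∨ t = 1) :
    s = 1 ∨ (t = 0 ∧ s = C / A) ∨ (t = 1 ∧ s = 0) := by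
  by_contra! hne
  have hmem := hx.1
  simp only [cutSquare, Set.mem_ofPred_eq] at hmem
  obtain ⟨h1, h2, h3, h4, h5⟩ := hmem
  have hA0 : 0 < A := hC.trans hA
  have hs1 : s < 1 := lt_of_le_of_ne h2 hne.1
  have key : ∀ e : ℝ, 0 < e → (s + e, t + 0) ∈ cutSquare A B C →
      (s - e, t - 0) ∈ cutSquare A B C → False := fun e he ha hb => by
    have := eq_zero_of_add_mem_of_sub_mem (v := ((e, 0) : ℝ × ℝ)) hx ha hb
    simp at this
    exact he.ne' this
  rcases ht with rfl | rfl
  · have hs : C / A < s :=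
      lt_of_le_of_ne (by rw [div_le_iff₀ hA0]; linarith) (Ne.symm (hne.2.1 rfl))
    have hCA : 0 < C / A := div_pos hC hA0
    have hm : A * (C / A) = C := mul_div_cancel₀ _ hA0.ne'
    have he : 0 < min (1 - s) (s - C / A) := lt_min (by linarith) (by linarith)
    have e1 := min_le_left (1 - s) (s - C / A)
    have e2 := min_le_right (1 - s) (s - C / A)
    refine key _ he ⟨?_, ?_, ?_, ?_, ?_⟩ ⟨?_, ?_, ?_, ?_, ?_⟩ <;> simp only <;> nlinarith
  · have hs : 0 < s := lt_of_le_of_ne h1 (Ne.symm (hne.2.2 rfl))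
    have he : 0 < min (1 - s) s := lt_min (by linarith) (by linarith)
    have e1 := min_le_left (1 - s) s
    have e2 := min_le_right (1 - s) s
    refine key _ he ⟨?_, ?_, ?_, ?_, ?_⟩ ⟨?_, ?_, ?_, ?_, ?_⟩ <;> simp only <;> nlinarith

theorem boundary_of_extremePoint_cutSquare (hA : 0 < A) (hB : 0 < B) {s t : ℝ}
    (hx : (s, t) ∈ (cutSquare A B C).extremePoints ℝ) :
    (t = 0 ∨ t = 1) ∨ (s = 0 ∨ s = 1) := by
  by_contra! hne
  obtain ⟨h1, h2, h3, h4, h5⟩ := hx.1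
  simp only at h1 h2 h3 h4 h5
  have hs0 : 0 < s := lt_of_le_of_ne h1 (Ne.symm hne.2.1)
  have hs1 : s < 1 := lt_of_le_of_ne h2 hne.2.2
  have ht0 : 0 < t := lt_of_le_of_ne h3 (Ne.symm hne.1.1)
  have ht1 : t < 1 := lt_of_le_of_ne h4 hne.1.2
  obtain ⟨e, he, e1, e2, e3, e4⟩ :
      ∃ e : ℝ, 0 < e ∧ e * B ≤ s ∧ e * B ≤ 1 - s ∧ e * A ≤ t ∧ e * A ≤ 1 - t := by
    refine ⟨min (min s (1 - s) / B) (min t (1 - t) / A), ?_, ?_⟩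
    · exact lt_min (div_pos (lt_min hs0 (by linarith)) hB) (div_pos (lt_min ht0 (by linarith)) hA)
    · have l1 := (le_div_iff₀ hB).1 (min_le_left (min s (1 - s) / B) (min t (1 - t) / A))
      have l2 := (le_div_iff₀ hA).1 (min_le_right (min s (1 - s) / B) (min t (1 - t) / A))
      exact ⟨l1.trans (min_le_left _ _), l1.trans (min_le_right _ _),
        l2.trans (min_le_left _ _), l2.trans (min_le_right _ _)⟩
  have heB : 0 < e * B := mul_pos he hB
  have heA : 0 < e * A := mul_pos he hA
  have := eq_zero_of_add_mem_of_sub_mem (v := ((e * B, -(e * A)) : ℝ × ℝ)) hx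
    (by refine ⟨?_, ?_, ?_, ?_, ?_⟩ <;> simp only [Prod.fst_add, Prod.snd_add] <;> linarith)
    (by refine ⟨?_, ?_, ?_, ?_, ?_⟩ <;> simp only [Prod.fst_sub, Prod.snd_sub] <;> linarith)
  exact heB.ne' (congrArg Prod.fst this)

theorem mk_zero_mem_extremePoints_cutSquare (hC : 0 < C) (hA : C < A) :
    (C / A, (0 : ℝ)) ∈ (cutSquare A B C).extremePoints ℝ := by
  have hA0 : 0 < A := hC.trans hA
  have hm : A * (C / A) = C := mul_div_cancel₀ _ hA0.ne'
  refine ⟨⟨(div_pos hC hA0).le, (div_le_one hA0).2 hA.le, le_rfl, zero_le_one, by simp [hm]⟩, ?_⟩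
  rintro ⟨y1, y2⟩ ⟨-, -, y3, -, y5⟩ ⟨z1, z2⟩ ⟨-, -, z3, -, z5⟩ ⟨a, b, ha, hb, hab, h⟩
  simp only [Prod.smul_mk, smul_eq_mul, Prod.mk_add_mk, Prod.mk.injEq] at h y3 y5 z3 z5
  have e2 := eq_of_convex_combination_eq_of_le ha hb hab y3 z3 h.2
  have e1 := eq_of_convex_combination_eq_of_le ha hb hab y5 z5
    (by linear_combination A * h.1 + B * h.2 + hm)
  rw [Prod.mk.injEq]
  exact ⟨by rw [eq_div_iff hA0.ne']; rw [e2] at e1; linarith, e2⟩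

theorem one_zero_mem_extremePoints_cutSquare (hA : C < A) :
    ((1 : ℝ), (0 : ℝ)) ∈ (cutSquare A B C).extremePoints ℝ := by
  refine ⟨⟨zero_le_one, le_rfl, le_rfl, zero_le_one, by simp [hA.le]⟩, ?_⟩
  rintro ⟨y1, y2⟩ ⟨-, y4, y3, -, -⟩ ⟨z1, z2⟩ ⟨-, z4, z3, -, -⟩ ⟨a, b, ha, hb, hab, h⟩
  simp only [Prod.smul_mk, smul_eq_mul, Prod.mk_add_mk, Prod.mk.injEq] at h y3 y4 z3 z4
  rw [Prod.mk.injEq]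
  exact ⟨eq_of_convex_combination_eq_of_ge ha hb hab y4 z4 h.1,
    eq_of_convex_combination_eq_of_le ha hb hab y3 z3 h.2⟩

theorem one_one_mem_extremePoints_cutSquare (hC : 0 < C) (hA : C < A) (hB : C < B) :
    ((1 : ℝ), (1 : ℝ)) ∈ (cutSquare A B C).extremePoints ℝ := by
  refine ⟨⟨zero_le_one, le_rfl, zero_le_one, le_rfl, by simp only; linarith⟩, ?_⟩
  rintro ⟨y1, y2⟩ ⟨-, y4, -, y3, -⟩ ⟨z1, z2⟩ ⟨-, z4, -, z3, -⟩ ⟨a, b, ha, hb, hab, h⟩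
  simp only [Prod.smul_mk, smul_eq_mul, Prod.mk_add_mk, Prod.mk.injEq] at h y3 y4 z3 z4
  rw [Prod.mk.injEq]
  exact ⟨eq_of_convex_combination_eq_of_ge ha hb hab y4 z4 h.1,
    eq_of_convex_combination_eq_of_ge ha hb hab y3 z3 h.2⟩

theorem extremePoints_cutSquare (hC : 0 < C) (hA : C < A) (hB : C < B) :
    (cutSquare A B C).extremePoints ℝ = {(C / A, 0), (1, 0), (1, 1), (0, 1), (0, C / B)} := by
  ext ⟨s, t⟩
  simp only [Set.mem_insert_iff, Set.mem_singleton_iff, Prod.mk.injEq]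
  constructor
  · intro hx
    have hx' : (t, s) ∈ (cutSquare B A C).extremePoints ℝ := swap_mem_extremePoints_cutSquare hx
    rcases boundary_of_extremePoint_cutSquare (hC.trans hA) (hC.trans hB) hx with h | h
    · have := fst_mem_of_extremePoint_cutSquare hC hA hB hx h
      tauto
    · have := fst_mem_of_extremePoint_cutSquare hC hB hA hx' h
      tauto
  · rintro (⟨rfl, rfl⟩ | ⟨rfl, rfl⟩ | ⟨rfl, rfl⟩ | ⟨rfl, rfl⟩ | ⟨rfl, rfl⟩)
    · exact mk_zero_mem_extremePoints_cutSquare hC hA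
    · exact one_zero_mem_extremePoints_cutSquare hA
    · exact one_one_mem_extremePoints_cutSquare hC hA hB
    · exact swap_mem_extremePoints_cutSquare (one_zero_mem_extremePoints_cutSquare hB)
    · exact swap_mem_extremePoints_cutSquare (mk_zero_mem_extremePoints_cutSquare hC hB)

theorem ncard_extremePoints_cutSquare (hC : 0 < C) (hA : C < A) (hB : C < B) :
    ((cutSquare A B C).extremePoints ℝ).ncard = 5 := by
  have hA0 : 0 < A := hC.trans hA
  have hB0 : 0 < B := hC.trans hB
  have a1 : C / A ≠ 1 := ((div_lt_one hA0).2 hA).ne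
  have a0 : C / A ≠ 0 := (div_pos hC hA0).ne'
  have b1 : (1 : ℝ) ≠ C / B := ((div_lt_one hB0).2 hB).ne'
  have b0 : C / B ≠ 0 := (div_pos hC hB0).ne'
  rw [extremePoints_cutSquare hC hA hB, Set.ncard_insert_of_notMem, Set.ncard_insert_of_notMem,
    Set.ncard_insert_of_notMem, Set.ncard_insert_of_notMem, Set.ncard_singleton] <;>
  simp only [Set.mem_insert_iff, Set.mem_singleton_iff, Prod.mk.injEq] <;>
  simp [a1, a0, b1, b0.symm]

theorem vectorSpan_cutSquare (hC : 0 < C) (hA : C < A) (hB : C < B) :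
    vectorSpan ℝ (cutSquare A B C) = ⊤ := by
  have m11 := (one_one_mem_extremePoints_cutSquare hC hA hB).1
  have m10 := (one_zero_mem_extremePoints_cutSquare (B := B) hA).1
  have m01 : ((0 : ℝ), (1 : ℝ)) ∈ cutSquare A B C :=
    swap_mem_cutSquare.2 (one_zero_mem_extremePoints_cutSquare (B := A) hB).1
  rw [eq_top_iff]
  rintro ⟨s, t⟩ -
  have h := add_mem (Submodule.smul_mem _ s (vsub_mem_vectorSpan ℝ m11 m01))
    (Submodule.smul_mem _ t (vsub_mem_vectorSpan ℝ m11 m10))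
  simpa using h

end Pentagon

section Combinatorics

/-- Let `F` be an upward closed family of subsets of a finite type which contains the whole type
but no set with at most one element. Then there are at least as many pairs `(S, i)`, where `i` is
one of at least two critical elements of `S ∈ F`, as there are elements. -/
theorem exists_injective_critical_pairs {α : Type*} [Fintype α] [DecidableEq α] [Nonempty α]
    (F : Finset α → Prop) (hmono : ∀ S T, S ⊆ T → F S → F T) (huniv : F Finset.univ)
    (hsingle : ∀ i, ¬ F {i}) :
    ∃ (S : α → Finset α) (i j : α → α), Function.Injective (fun k => (S k, i k)) ∧
      ∀ k, i k ∈ S k ∧ j k ∈ S k ∧ i k ≠ j k ∧ F (S k) ∧ ¬ F ((S k).erase (i k)) ∧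
        ¬ F ((S k).erase (j k)) := by
  have herase : ∀ S, Minimal F S → ∀ i ∈ S, ¬ F (S.erase i) := fun S hS i hi h =>
    Finset.notMem_erase i S (hS.le_of_le h (Finset.erase_subset i S) hi)
  have hother : ∀ S, F S → ∀ i, ∃ j ∈ S, i ≠ j := by
    intro S hS i
    by_contra! h
    exact hsingle i (hmono S {i} (fun j hj => by simp [h j hj]) hS)
  obtain ⟨S₀, -, hS₀⟩ := exists_minimal_le_of_wellFoundedLT F _ huniv
  obtain ⟨i₀, hi₀, -⟩ := hother S₀ hS₀.prop (Classical.arbitrary α)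
  obtain ⟨j₀, hj₀, hij₀⟩ := hother S₀ hS₀.prop i₀
  have hS : ∀ k, ∃ (S : Finset α) (i j : α), (i ∈ S ∧ j ∈ S ∧ i ≠ j ∧ F S ∧ ¬ F (S.erase i) ∧
      ¬ F (S.erase j)) ∧ ((Minimal F S ∧ i = k) ∨
        ((∀ T, Minimal F T → k ∉ T) ∧ S = insert k S₀ ∧ i = i₀)) := by
    intro k
    by_cases hk : ∃ S, Minimal F S ∧ k ∈ S
    · obtain ⟨S, hS, hkS⟩ := hk
      obtain ⟨j, hj, hkj⟩ := hother S hS.prop k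
      exact ⟨S, k, j, ⟨hkS, hj, hkj, hS.prop, herase S hS k hkS, herase S hS j hj⟩,
        Or.inl ⟨hS, rfl⟩⟩
    · push Not at hk
      have hdrop : ∀ i ∈ S₀, ¬ F ((insert k S₀).erase i) := by
        intro i hi h
        obtain ⟨T, hT, hTmin⟩ := exists_minimal_le_of_wellFoundedLT F _ h
        have hTS : T ⊆ S₀.erase i := by
          intro x hx
          have hx' := hT hx
          have hxk : x ≠ k := fun e => hk T hTmin (e ▸ hx)
          simp only [Finset.mem_erase, Finset.mem_insert] at hx' ⊢
          tauto
        exact herase S₀ hS₀ i hi (hmono _ _ hTS hTmin.prop)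
      exact ⟨insert k S₀, i₀, j₀, ⟨Finset.mem_insert_of_mem hi₀, Finset.mem_insert_of_mem hj₀,
        hij₀, hmono _ _ (Finset.subset_insert k S₀) hS₀.prop, hdrop i₀ hi₀, hdrop j₀ hj₀⟩,
        Or.inr ⟨hk, rfl, rfl⟩⟩
  choose S i j hcrit hkind using hS
  refine ⟨S, i, j, fun k l hkl => ?_, hcrit⟩
  obtain ⟨hSkl, hikl⟩ := Prod.mk.inj hkl
  rcases hkind k with ⟨hk, hik⟩ | ⟨hk, hSk, -⟩ <;> rcases hkind l with ⟨hl, hil⟩ | ⟨hl, hSl, -⟩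
  · rw [← hik, ← hil, hikl]
  · exact absurd (by rw [hSkl, hSl]; exact Finset.mem_insert_self l S₀) (hl (S k) hk)
  · exact absurd (by rw [← hSkl, hSk]; exact Finset.mem_insert_self k S₀) (hk (S l) hl)
  · have : k ∈ insert l S₀ := by
      rw [← hSl, ← hSkl, hSk]
      exact Finset.mem_insert_self k S₀
    exact (Finset.mem_insert.1 this).resolve_right (hk S₀ hS₀)

end Combinatorics

section Cube

variable {d : ℕ}

theorem IsFace.isExtreme {P F : Set (EuclideanSpace ℝ (Fin d))} (h : IsFace P F) :
    IsExtreme ℝ P F := by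
  obtain ⟨c, rfl⟩ := h
  exact IsExposed.isExtreme fun _ => ⟨innerSL ℝ c, by simp⟩

/-- The plane through `u` spanned by the coordinate directions `i` and `j`, oriented so that the
unit square is mapped to a face of the cube when `u` is a vertex of the cube. -/
noncomputable def cubePlane (u : EuclideanSpace ℝ (Fin d)) (i j : Fin d) :
    ℝ × ℝ →ᵃ[ℝ] EuclideanSpace ℝ (Fin d) :=
  ((LinearMap.fst ℝ ℝ ℝ).smulRight (EuclideanSpace.single i (1 - 2 * u i)) +
    (LinearMap.snd ℝ ℝ ℝ).smulRight (EuclideanSpace.single j (1 - 2 * u j))).toAffineMap +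
      AffineMap.const ℝ (ℝ × ℝ) u

variable {u a : EuclideanSpace ℝ (Fin d)} {i j : Fin d} {β : ℝ}

theorem cubePlane_apply (x : ℝ × ℝ) (k : Fin d) :
    cubePlane u i j x k = (if k = i then x.1 * (1 - 2 * u i) else 0) +
      (if k = j then x.2 * (1 - 2 * u j) else 0) + u k := by
  simp [cubePlane]

theorem cubePlane_apply_left (hij : i ≠ j) (x : ℝ × ℝ) :
    cubePlane u i j x i = x.1 * (1 - 2 * u i) + u i := by
  simp [cubePlane_apply, hij]

theorem cubePlane_apply_right (hij : i ≠ j) (x : ℝ × ℝ) :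
    cubePlane u i j x j = x.2 * (1 - 2 * u j) + u j := by
  simp [cubePlane_apply, hij.symm]

theorem cubePlane_apply_of_ne (x : ℝ × ℝ) {k : Fin d} (hi : k ≠ i) (hj : k ≠ j) :
    cubePlane u i j x k = u k := by
  simp [cubePlane_apply, hi, hj]

theorem inner_cubePlane (x : ℝ × ℝ) :
    ⟪a, cubePlane u i j x⟫ =
      x.1 * ((1 - 2 * u i) * a i) + x.2 * ((1 - 2 * u j) * a j) + ⟪a, u⟫ := by
  simp [cubePlane, inner_add_right, inner_smul_right, EuclideanSpace.inner_single_right]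

theorem one_sub_two_mul_ne_zero {t : ℝ} (h : t = 0 ∨ t = 1) : 1 - 2 * t ≠ 0 := by
  rcases h with rfl | rfl <;> norm_num

theorem cubePlane_injective (hij : i ≠ j) (hu : ∀ k, u k = 0 ∨ u k = 1) :
    Function.Injective (cubePlane u i j) := by
  intro x y h
  have h1 := congrArg (fun z => z i) h
  have h2 := congrArg (fun z => z j) h
  simp only [cubePlane_apply_left hij, cubePlane_apply_right hij, add_left_inj] at h1 h2
  exact Prod.ext (mul_right_cancel₀ (one_sub_two_mul_ne_zero (hu i)) h1)
    (mul_right_cancel₀ (one_sub_two_mul_ne_zero (hu j)) h2)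

theorem image_cubePlane_cutSquare (hij : i ≠ j) (hu : ∀ k, u k = 0 ∨ u k = 1) :
    cubePlane u i j '' cutSquare (-((1 - 2 * u i) * a i)) (-((1 - 2 * u j) * a j)) (⟪a, u⟫ - β) =
      {x ∈ unitCube d ∩ {x | ⟪a, x⟫ ≤ β} | ∀ k, k ≠ i → k ≠ j → x k = u k} := by
  ext x
  constructor
  · rintro ⟨y, ⟨h1, h2, h3, h4, h5⟩, rfl⟩
    refine ⟨⟨fun k => ?_, ?_⟩, fun k hi hj => cubePlane_apply_of_ne y hi hj⟩
    · by_cases hi : k = i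
      · subst hi
        rw [cubePlane_apply_left hij]
        rcases hu k with h | h <;> rw [h] <;> constructor <;> linarith
      · by_cases hj : k = j
        · subst hj
          rw [cubePlane_apply_right hij]
          rcases hu k with h | h <;> rw [h] <;> constructor <;> linarith
        · rw [cubePlane_apply_of_ne y hi hj]
          rcases hu k with h | h <;> rw [h] <;> norm_num
    · change ⟪a, cubePlane u i j y⟫ ≤ β
      rw [inner_cubePlane]
      linarith
  · rintro ⟨⟨hcube, hβ⟩, hx⟩
    have hplane : cubePlane u i j ((x i - u i) * (1 - 2 * u i), (x j - u j) * (1 - 2 * u j)) = x := by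
      ext k
      by_cases hi : k = i
      · subst hi
        rw [cubePlane_apply_left hij]
        rcases hu k with h | h <;> rw [h] <;> ring
      · by_cases hj : k = j
        · subst hj
          rw [cubePlane_apply_right hij]
          rcases hu k with h | h <;> rw [h] <;> ring
        · rw [cubePlane_apply_of_ne _ hi hj, hx k hi hj]
    refine ⟨_, ?_, hplane⟩
    change ⟪a, x⟫ ≤ β at hβ
    rw [← hplane, inner_cubePlane] at hβ
    have hi := hcube i
    have hj := hcube j
    refine ⟨?_, ?_, ?_, ?_, by linarith⟩ <;> simp only
    · rcases hu i with h | h <;> rw [h] <;> linarith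
    · rcases hu i with h | h <;> rw [h] <;> linarith
    · rcases hu j with h | h <;> rw [h] <;> linarith
    · rcases hu j with h | h <;> rw [h] <;> linarith

theorem isFace_of_coordinates_eq {P : Set (EuclideanSpace ℝ (Fin d))} (hP : P ⊆ unitCube d)
    (hu : ∀ k, u k = 0 ∨ u k = 1) (p : Fin d → Prop)
    (hne : {x ∈ P | ∀ k, p k → x k = u k}.Nonempty) :
    IsFace P {x ∈ P | ∀ k, p k → x k = u k} := by
  classical
  let c : EuclideanSpace ℝ (Fin d) := WithLp.toLp 2 fun k => if p k then 2 * u k - 1 else 0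
  have hle : ∀ x ∈ unitCube d, ∀ k, c k * x k ≤ c k * u k := by
    intro x hx k
    have := hx k
    by_cases hk : p k
    · simp only [c, hk, if_true]
      rcases hu k with h | h <;> rw [h] <;> linarith
    · simp [c, hk]
  have hinner : ∀ x, ⟪c, x⟫ = ∑ k, c k * x k := fun x => by
    simp [PiLp.inner_apply, mul_comm]
  have hceq : ∀ x ∈ P, (∀ k, p k → x k = u k) → ⟪c, x⟫ = ⟪c, u⟫ := by
    intro x _ h
    rw [hinner, hinner]
    refine Finset.sum_congr rfl fun k _ => ?_
    by_cases hk : p k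
    · rw [h k hk]
    · simp [c, hk]
  refine ⟨c, Set.ext fun x => and_congr_right fun hx => ⟨fun h y hy => ?_, fun h => ?_⟩⟩
  · rw [hceq x hx h, hinner, hinner]
    exact Finset.sum_le_sum fun k _ => hle y (hP hy) k
  · obtain ⟨y, hy, hyu⟩ := hne
    have hsum := h y hy
    rw [hceq y hy hyu, hinner, hinner] at hsum
    have heq := (Finset.sum_eq_sum_iff_of_le fun k _ => hle x (hP hx) k).1
      (le_antisymm (Finset.sum_le_sum fun k _ => hle x (hP hx) k) hsum)
    intro k hk
    have := heq k (Finset.mem_univ k)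
    simp only [c, hk, if_true] at this
    rcases hu k with h | h <;> rw [h] at this ⊢ <;> linarith

/-- If `u` is a vertex of the cube that violates `⟪a, x⟫ ≤ β`, while its neighbours in the
directions `i` and `j` satisfy it strictly, then the point where the hyperplane meets the edge
at `u` in direction `i` is a vertex of a pentagonal face. -/
theorem exists_pentagonal_face (hij : i ≠ j) (hu : ∀ k, u k = 0 ∨ u k = 1) (hcut : β < ⟪a, u⟫)
    (hi : ⟪a, u⟫ + (1 - 2 * u i) * a i < β) (hj : ⟪a, u⟫ + (1 - 2 * u j) * a j < β) :
    ∃ p : EuclideanSpace ℝ (Fin d), p ∈ Set.extremePoints ℝ (unitCube d ∩ {x | ⟪a, x⟫ ≤ β}) ∧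
      ⟪a, p⟫ = β ∧ (0 < p i ∧ p i < 1) ∧ (∀ k, k ≠ i → p k = u k) ∧
      ∃ W, IsFace (unitCube d ∩ {x | ⟪a, x⟫ ≤ β}) W ∧
        Module.finrank ℝ (affineSpan ℝ W).direction = 2 ∧
        (Set.extremePoints ℝ W).ncard = 5 ∧ p ∈ Set.extremePoints ℝ W := by
  set A := -((1 - 2 * u i) * a i) with hAdef
  set B := -((1 - 2 * u j) * a j) with hBdef
  set C := ⟪a, u⟫ - β with hCdef
  have hC : 0 < C := sub_pos.2 hcut
  have hA : C < A := by linarith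
  have hB : C < B := by linarith
  have hA0 : 0 < A := hC.trans hA
  have hτ0 : 0 < C / A := div_pos hC hA0
  have hτ1 : C / A < 1 := (div_lt_one hA0).2 hA
  have hinj := cubePlane_injective hij hu
  have hτ := mk_zero_mem_extremePoints_cutSquare (B := B) hC hA
  have hW := image_cubePlane_cutSquare (a := a) (β := β) hij hu
  rw [← hAdef, ← hBdef, ← hCdef] at hW
  have hface : IsFace (unitCube d ∩ {x | ⟪a, x⟫ ≤ β}) (cubePlane u i j '' cutSquare A B C) := by
    have := isFace_of_coordinates_eq (P := unitCube d ∩ {x | ⟪a, x⟫ ≤ β})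
      Set.inter_subset_left hu (fun k => k ≠ i ∧ k ≠ j)
    simp only [and_imp] at this
    rw [← hW] at this
    exact this ⟨_, _, hτ.1, rfl⟩
  have hext := AffineMap.image_extremePoints_of_injective _ hinj (cutSquare A B C)
  have hp : cubePlane u i j (C / A, 0) ∈
      Set.extremePoints ℝ (cubePlane u i j '' cutSquare A B C) := hext ▸ ⟨_, hτ, rfl⟩
  refine ⟨cubePlane u i j (C / A, 0), hface.isExtreme.extremePoints_subset_extremePoints hp,
    ?_, ?_, fun k hk => ?_, _, hface, ?_, ?_, hp⟩
  · have hm : C / A * A = C := div_mul_cancel₀ _ hA0.ne'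
    linear_combination inner_cubePlane (a := a) (u := u) (i := i) (j := j) (C / A, 0) -
      C / A * hAdef - hm - hCdef
  · rw [cubePlane_apply_left hij]
    simp only
    rcases hu i with h | h <;> rw [h] <;> constructor <;> linarith
  · simp [cubePlane_apply, hk]
  · rw [direction_affineSpan, ← AffineMap.map_vectorSpan, vectorSpan_cutSquare hC hA hB,
      Submodule.map_top, LinearMap.finrank_range_of_inj]
    · simp
    · exact (AffineMap.linear_injective_iff _).2 hinj
  · rw [hext, Set.ncard_image_of_injective _ hinj, ncard_extremePoints_cutSquare hC hA hB]

/-- The vertex of the cube maximizing the functional `a` in the coordinates of `S` and minimizing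
it in all the others. -/
noncomputable def signedVertex (a : EuclideanSpace ℝ (Fin d)) (S : Finset (Fin d)) :
    EuclideanSpace ℝ (Fin d) :=
  WithLp.toLp 2 fun k => if (k ∈ S ↔ 0 ≤ a k) then 1 else 0

theorem signedVertex_apply (S : Finset (Fin d)) (k : Fin d) :
    signedVertex a S k = if (k ∈ S ↔ 0 ≤ a k) then 1 else 0 := rfl

theorem signedVertex_eq_zero_or_one (S : Finset (Fin d)) (k : Fin d) :
    signedVertex a S k = 0 ∨ signedVertex a S k = 1 := by
  rw [signedVertex_apply]
  split_ifs <;> simp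

theorem signedVertex_apply_inj {S T : Finset (Fin d)} {k : Fin d}
    (h : signedVertex a S k = signedVertex a T k) : k ∈ S ↔ k ∈ T := by
  simp only [signedVertex_apply] at h
  by_cases h1 : k ∈ S <;> by_cases h2 : k ∈ T <;> by_cases h3 : 0 ≤ a k <;> simp_all

theorem mul_le_mul_signedVertex {S : Finset (Fin d)} {k : Fin d} (hk : k ∈ S) {t : ℝ}
    (h0 : 0 ≤ t) (h1 : t ≤ 1) : a k * t ≤ a k * signedVertex a S k := by
  rw [signedVertex_apply]
  by_cases h : 0 ≤ a k
  · simp only [hk, h, if_true]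
    nlinarith
  · simp only [hk, h, iff_false, not_true, if_false]
    nlinarith

theorem mul_signedVertex_le_mul {S : Finset (Fin d)} {k : Fin d} (hk : k ∉ S) {t : ℝ}
    (h0 : 0 ≤ t) (h1 : t ≤ 1) : a k * signedVertex a S k ≤ a k * t := by
  rw [signedVertex_apply]
  by_cases h : 0 ≤ a k
  · simp only [hk, h, false_iff, not_true, if_false]
    nlinarith
  · simp only [hk, h, if_true]
    nlinarith

theorem inner_signedVertex_erase {S : Finset (Fin d)} (hi : i ∈ S) :
    ⟪a, signedVertex a (S.erase i)⟫ =
      ⟪a, signedVertex a S⟫ + (1 - 2 * signedVertex a S i) * a i := by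
  have : signedVertex a (S.erase i) =
      signedVertex a S + EuclideanSpace.single i (1 - 2 * signedVertex a S i) := by
    ext k
    by_cases hk : k = i
    · subst hk
      simp only [PiLp.add_apply, signedVertex_apply, hi, Finset.notMem_erase]
      by_cases h : 0 ≤ a k <;> norm_num [h]
    · simp [signedVertex_apply, hk]
  rw [this, inner_add_right, EuclideanSpace.inner_single_right]
  simp

theorem inner_le_inner_of_forall {x y : EuclideanSpace ℝ (Fin d)}
    (h : ∀ k, a k * x k ≤ a k * y k) : ⟪a, x⟫ ≤ ⟪a, y⟫ := by
  simp only [PiLp.inner_apply, RCLike.inner_apply, conj_trivial]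
  exact Finset.sum_le_sum fun k _ => by simpa only [mul_comm] using h k

theorem inner_signedVertex_mono {S T : Finset (Fin d)} (h : S ⊆ T) :
    ⟪a, signedVertex a S⟫ ≤ ⟪a, signedVertex a T⟫ := by
  refine inner_le_inner_of_forall fun k => ?_
  have h01 := signedVertex_eq_zero_or_one (a := a) S k
  have h01' := signedVertex_eq_zero_or_one (a := a) T k
  by_cases hk : k ∈ T
  · exact mul_le_mul_signedVertex hk (by rcases h01 with h | h <;> simp [h])
      (by rcases h01 with h | h <;> simp [h])
  · exact mul_signedVertex_le_mul (fun hS => hk (h hS)) (by rcases h01' with h | h <;> simp [h])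
      (by rcases h01' with h | h <;> simp [h])

end Cube

theorem stmt_3 {d : ℕ} (hd : 2 ≤ d) (a : EuclideanSpace ℝ (Fin d)) (β : ℝ)
    (H : Set (EuclideanSpace ℝ (Fin d))) (hH : H = {x | ⟪a, x⟫ ≤ β})
    (h1 : ¬ unitCube d ⊆ H)
    (h2 : ∀ i : Fin d, ∀ ε : ℝ, (ε = 0 ∨ ε = 1) →
      ({x ∈ unitCube d | x i = ε} ∩ H).Nonempty)
    (h3 : ∀ v : EuclideanSpace ℝ (Fin d), (∀ i, v i = 0 ∨ v i = 1) → ⟪a, v⟫ ≠ β) :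
    ∃ p : Fin d → EuclideanSpace ℝ (Fin d), Function.Injective p ∧
      ∀ k, p k ∈ Set.extremePoints ℝ (unitCube d ∩ H) ∧ ⟪a, p k⟫ = β ∧
        ∃ W, IsFace (unitCube d ∩ H) W ∧
          Module.finrank ℝ (affineSpan ℝ W).direction = 2 ∧
          (Set.extremePoints ℝ W).ncard = 5 ∧
          p k ∈ Set.extremePoints ℝ W := by
  subst hH
  have : Nonempty (Fin d) := ⟨⟨0, by omega⟩⟩
  have huniv : β < ⟪a, signedVertex a Finset.univ⟫ := by
    obtain ⟨x, hx, hxH⟩ := Set.not_subset.1 h1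
    exact (not_le.1 hxH).trans_le (inner_le_inner_of_forall fun k =>
      mul_le_mul_signedVertex (Finset.mem_univ k) (hx k).1 (hx k).2)
  have hsingle : ∀ i, ¬ β < ⟪a, signedVertex a {i}⟫ := by
    intro i
    obtain ⟨x, ⟨hx, hxi⟩, hxH⟩ := h2 i _ (signedVertex_eq_zero_or_one (a := a) {i} i)
    refine not_lt.2 (le_trans (inner_le_inner_of_forall fun k => ?_) hxH)
    by_cases hk : k = i
    · rw [hk, hxi]
    · exact mul_signedVertex_le_mul (by simpa using hk) (hx k).1 (hx k).2
  obtain ⟨S, i, j, hinj, hcrit⟩ := exists_injective_critical_pairs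
    (fun S => β < ⟪a, signedVertex a S⟫)
    (fun S T hST hS => hS.trans_le (inner_signedVertex_mono hST)) huniv hsingle
  have hlt : ∀ {T : Finset (Fin d)}, ¬ β < ⟪a, signedVertex a T⟫ →
      ⟪a, signedVertex a T⟫ < β := fun {T} h =>
    lt_of_le_of_ne (not_lt.1 h) (h3 _ (signedVertex_eq_zero_or_one T))
  have hp := fun k => by
    obtain ⟨hi, hj, hij, hcut, hci, hcj⟩ := hcrit k
    exact exists_pentagonal_face hij (signedVertex_eq_zero_or_one (S k)) hcut
      (inner_signedVertex_erase hi ▸ hlt hci) (inner_signedVertex_erase hj ▸ hlt hcj)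
  choose p hext hβ hpi hpu hface using hp
  refine ⟨p, fun k l hkl => hinj ?_, fun k => ⟨hext k, hβ k, hface k⟩⟩
  have hikl : i k = i l := by
    by_contra hne
    have h01 := signedVertex_eq_zero_or_one (a := a) (S l) (i k)
    have h := hpi k
    rw [hkl, hpu l _ hne] at h
    rcases h01 with e | e <;> rw [e] at h <;> linarith [h.1, h.2]
  refine Prod.ext (Finset.ext fun m => ?_) hikl
  by_cases hm : m = i k
  · exact iff_of_true (hm ▸ (hcrit k).1) (hm ▸ hikl ▸ (hcrit l).1)
  · refine signedVertex_apply_inj (a := a) ?_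
    rw [← hpu k m hm, ← hpu l m (hikl ▸ hm), hkl]
end

section
/- Let B₀, B₁ ⊆ ℝ^d be polytopes, let F be a nonempty face of B₀, and let P = conv((B₀ × {0}) ∪ (B₁ × {1})) ⊆ ℝ^{d+1}. Then (relint(F) × (0, ∞)) ∩ P = ∅ if and only if there exist a ∈ ℝ^d and β ∈ ℝ such that B₀ ⊆ {x : ⟨a, x⟩ ≤ β}, B₀ ∩ {x : ⟨a, x⟩ = β} = F, and B₁ ⊆ {x : ⟨a, x⟩ < β} (i.e., there is a half-space that strictly supports B₀ at F and contains B₁ in its interior). -/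
open RealInnerProductSpace

open Set

/-- A point of the intrinsic interior of `s` can be pushed a little away from any point of the
affine span of `s` without leaving `s`. -/
theorem exists_pos_lineMap_neg_mem {V : Type*} [NormedAddCommGroup V] [NormedSpace ℝ V]
    {s : Set V} {x y : V} (hx : x ∈ intrinsicInterior ℝ s) (hy : y ∈ affineSpan ℝ s) :
    ∃ ε : ℝ, 0 < ε ∧ AffineMap.lineMap x y (-ε) ∈ s := by
  obtain ⟨x', hx', rfl⟩ := mem_intrinsicInterior.1 hx
  let g : ℝ → affineSpan ℝ s := fun r =>
    ⟨AffineMap.lineMap (x' : V) y (-r), AffineMap.lineMap_mem _ x'.2 hy⟩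
  have hg : Continuous g := by
    refine Continuous.subtype_mk ?_ _
    simp only [AffineMap.lineMap_apply_module]
    fun_prop
  have hg0 : g 0 = x' := Subtype.ext (by simp [g])
  have hmem : g ⁻¹' interior ((↑) ⁻¹' s) ∈ nhds (0 : ℝ) :=
    (isOpen_interior.preimage hg).mem_nhds (by simpa [hg0] using hx')
  obtain ⟨δ, hδ, hball⟩ := Metric.mem_nhds_iff.1 hmem
  refine ⟨δ / 2, by positivity, ?_⟩
  have : δ / 2 ∈ Metric.ball (0 : ℝ) δ := by
    rw [Metric.mem_ball, Real.dist_eq, sub_zero, abs_of_pos (by positivity)]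
    linarith
  have hs : g (δ / 2) ∈ ((↑) ⁻¹' s : Set (affineSpan ℝ s)) := interior_subset (hball this)
  exact hs

/-- A linear functional that is bounded below on an affine subspace is constant on it. -/
theorem AffineSubspace.eq_of_forall_lt_apply {V : Type*} [AddCommGroup V] [Module ℝ V]
    {A : AffineSubspace ℝ V} {f : V →ₗ[ℝ] ℝ} {v : ℝ} (hf : ∀ z ∈ A, v < f z)
    {x y : V} (hx : x ∈ A) (hy : y ∈ A) : f y = f x := by
  by_contra hne
  have hd : f y - f x ≠ 0 := sub_ne_zero.2 hne
  have := hf _ (AffineMap.lineMap_mem ((v - f x) / (f y - f x)) hx hy)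
  rw [AffineMap.lineMap_apply_module'] at this
  simp only [map_add, map_smul, map_sub, smul_eq_mul] at this
  rw [div_mul_cancel₀ _ hd] at this
  linarith

/-- If a linear functional `f` is equal to `β` on a convex set `F`, then the union of `F` and the
open half-space where `f` is less than `β` is convex. -/
theorem convex_union_setOf_lt {V : Type*} [AddCommGroup V] [Module ℝ V] {F : Set V}
    (hF : Convex ℝ F) {f : V →ₗ[ℝ] ℝ} {β : ℝ} (hfF : ∀ x ∈ F, f x = β) :
    Convex ℝ (F ∪ {x | f x < β}) := by
  have hle : ∀ x ∈ F ∪ {x | f x < β}, f x ≤ β := by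
    rintro x (hx | hx)
    · exact (hfF x hx).le
    · exact le_of_lt hx
  rw [convex_iff_forall_pos]
  intro x hx y hy a b ha hb hab
  by_cases h : x ∈ F ∧ y ∈ F
  · exact Or.inl (hF h.1 h.2 ha.le hb.le hab)
  · right
    have hx' := hle x hx
    have hy' := hle y hy
    have hb' : b = 1 - a := by linarith
    simp only [mem_ofPred_eq, map_add, map_smul, smul_eq_mul]
    rcases hx with hx | hx
    · rcases hy with hy | hy
      · exact absurd ⟨hx, hy⟩ h
      · have hy : f y < β := hy
        subst hb'
        nlinarith
    · have hx : f x < β := hx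
      subst hb'
      nlinarith

/-- Over a convex set `P` in `V × ℝ`, the points of height zero at which `f` is less than `m`,
together with the points of positive height, project to a convex set. -/
theorem convex_setOf_exists_height {V : Type*} [AddCommGroup V] [Module ℝ V] {P : Set (V × ℝ)}
    (hP : Convex ℝ P) (f : V →ₗ[ℝ] ℝ) (m : ℝ) :
    Convex ℝ {y | ∃ t : ℝ, (y, t) ∈ P ∧ 0 ≤ t ∧ (t = 0 → f y < m)} := by
  rw [convex_iff_forall_pos]
  rintro x ⟨t, hxt, ht, htx⟩ y ⟨r, hyr, hr, hry⟩ a b ha hb hab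
  refine ⟨a * t + b * r, hP hxt hyr ha.le hb.le hab, by positivity, fun h => ?_⟩
  have h1 : a * t = 0 := by nlinarith [mul_nonneg ha.le ht, mul_nonneg hb.le hr]
  have h2 : b * r = 0 := by linarith
  have hx := htx ((mul_eq_zero.1 h1).resolve_left ha.ne')
  have hy := hry ((mul_eq_zero.1 h2).resolve_left hb.ne')
  obtain rfl : b = 1 - a := by linarith
  simp only [map_add, map_smul, smul_eq_mul]
  nlinarith

theorem stmt_6 {d : ℕ} (B₀ B₁ F : Set (EuclideanSpace ℝ (Fin d)))
    (hB₀ : IsPolytope B₀) (hB₁ : IsPolytope B₁)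
    (hF : IsFace B₀ F) (hFne : F.Nonempty) :
    (intrinsicInterior ℝ F ×ˢ Set.Ioi (0 : ℝ)) ∩
        convexHull ℝ ((B₀ ×ˢ ({0} : Set ℝ)) ∪ (B₁ ×ˢ ({1} : Set ℝ))) = ∅ ↔
      ∃ (a : EuclideanSpace ℝ (Fin d)) (β : ℝ),
        B₀ ⊆ {x | ⟪a, x⟫ ≤ β} ∧ {x ∈ B₀ | ⟪a, x⟫ = β} = F ∧
        ∀ x ∈ B₁, ⟪a, x⟫ < β := by
  constructor
  · intro hdisj
    obtain ⟨S₀, rfl⟩ := hB₀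
    obtain ⟨S₁, rfl⟩ := hB₁
    obtain ⟨c, rfl⟩ := hF
    set B₀ := convexHull ℝ (S₀ : Set (EuclideanSpace ℝ (Fin d)))
    set B₁ := convexHull ℝ (S₁ : Set (EuclideanSpace ℝ (Fin d)))
    set F := {x ∈ B₀ | ∀ y ∈ B₀, ⟪c, y⟫ ≤ ⟪c, x⟫}
    set P := convexHull ℝ ((B₀ ×ˢ ({0} : Set ℝ)) ∪ (B₁ ×ˢ ({1} : Set ℝ)))
    obtain ⟨p, hp⟩ := hFne
    set m := ⟪c, p⟫
    have hle : ∀ y ∈ B₀, ⟪c, y⟫ ≤ m := hp.2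
    have hFeq : F = B₀ ∩ {x | innerₛₗ ℝ c x = m} := by
      ext x
      refine ⟨fun hx => ⟨hx.1, le_antisymm (hle x hx.1) (hx.2 p hp.1)⟩, fun hx => ⟨hx.1, ?_⟩⟩
      have h : ⟪c, x⟫ = m := hx.2
      simpa only [h] using hle
    have hFconv : Convex ℝ F := by
      rw [hFeq]
      exact (convex_convexHull ℝ _).inter (convex_hyperplane (innerₛₗ ℝ c).isLinear m)
    have hFB : F ⊆ B₀ := fun x hx => hx.1
    have hPconv : Convex ℝ P := convex_convexHull ℝ _
    have hP₀ : ∀ x ∈ B₀, (x, (0 : ℝ)) ∈ P := fun x hx =>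
      subset_convexHull ℝ _ (Or.inl ⟨hx, rfl⟩)
    have hP₁ : ∀ x ∈ B₁, (x, (1 : ℝ)) ∈ P := fun x hx =>
      subset_convexHull ℝ _ (Or.inr ⟨hx, rfl⟩)
    obtain ⟨x₀, hx₀⟩ := Set.Nonempty.intrinsicInterior hFconv ⟨p, hp⟩
    have hspan : ∀ y ∈ affineSpan ℝ F, ⟪c, y⟫ = m := by
      intro y hy
      have h := affineSpan_induction (p := fun y => ⟪c, y⟫ = m) hy
        (fun x hx => (hFeq ▸ hx : x ∈ B₀ ∩ _).2)
        (fun r u v w hu hv hw => by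
          simp only [vsub_eq_sub, vadd_eq_add, inner_add_right, inner_smul_right, inner_sub_right]
          rw [hu, hv, hw]; ring)
      exact h
    set T : Set (EuclideanSpace ℝ (Fin d)) := ((S₀ : Set _) \ F) ∪ S₁
    have hTfin : T.Finite := (S₀.finite_toSet.subset sdiff_subset).union S₁.finite_toSet
    have hTQ : convexHull ℝ T ⊆ _ :=
      convexHull_min (s := T) ?_ (convex_setOf_exists_height hPconv (innerₛₗ ℝ c) m)
    swap
    · rintro x (⟨hx, hxF⟩ | hx)
      · have hxB : x ∈ B₀ := subset_convexHull ℝ _ hx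
        refine ⟨0, hP₀ x hxB, le_rfl, fun _ => lt_of_le_of_ne (hle x hxB) fun h => hxF ?_⟩
        rw [hFeq]
        exact ⟨hxB, h⟩
      · exact ⟨1, hP₁ x (subset_convexHull ℝ _ hx), zero_le_one, fun h => absurd h one_ne_zero⟩
    have hTF : Disjoint (convexHull ℝ T) (affineSpan ℝ F : Set (EuclideanSpace ℝ (Fin d))) := by
      rw [disjoint_left]
      intro y hyT hyF
      obtain ⟨t, hyt, ht, htm⟩ := hTQ hyT
      rcases ht.eq_or_lt with rfl | ht
      · exact (htm rfl).ne (hspan y hyF)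
      · obtain ⟨ε, hε, hz⟩ := exists_pos_lineMap_neg_mem hx₀ hyF
        have hmem := hPconv (hP₀ _ (hFB hz)) hyt (a := 1 / (1 + ε)) (b := ε / (1 + ε))
          (by positivity) (by positivity) (by field_simp)
        have heq : (1 / (1 + ε)) • AffineMap.lineMap x₀ y (-ε) + (ε / (1 + ε)) • y = x₀ := by
          rw [AffineMap.lineMap_apply_module]
          match_scalars
          · field_simp
            ring
          · field_simp
            ring
        rw [Prod.smul_mk, Prod.smul_mk, Prod.mk_add_mk, heq] at hmem
        refine eq_empty_iff_forall_notMem.1 hdisj _ ⟨⟨hx₀, ?_⟩, hmem⟩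
        simp only [smul_eq_mul, mul_zero, zero_add, mem_Ioi]
        positivity
    obtain ⟨f, u, v, hfT, huv, hfF⟩ := geometric_hahn_banach_compact_closed
      (convex_convexHull ℝ T) (hTfin.isCompact_convexHull (𝕜 := ℝ)) (affineSpan ℝ F).convex
      (affineSpan ℝ F).closed_of_finiteDimensional hTF
    have hpF : p ∈ affineSpan ℝ F := subset_affineSpan ℝ _ hp
    have hconst : ∀ x ∈ F, (f : EuclideanSpace ℝ (Fin d) →ₗ[ℝ] ℝ) x = f p := fun x hx =>
      AffineSubspace.eq_of_forall_lt_apply (f := (f : EuclideanSpace ℝ (Fin d) →ₗ[ℝ] ℝ)) hfF hpF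
        (subset_affineSpan ℝ _ hx)
    have hlt : ∀ x ∈ T, f x < f p := fun x hx =>
      ((hfT x (subset_convexHull ℝ _ hx)).trans huv).trans (hfF p hpF)
    have hB₀F : B₀ ⊆ F ∪ {x | f x < f p} := by
      refine convexHull_min (fun x hx => ?_) (convex_union_setOf_lt hFconv hconst)
      by_cases hxF : x ∈ F
      · exact Or.inl hxF
      · exact Or.inr (hlt x (Or.inl ⟨hx, hxF⟩))
    have hB₁f : B₁ ⊆ {x | f x < f p} :=
      convexHull_min (fun x hx => hlt x (Or.inr hx))
        (convex_halfSpace_lt (f : EuclideanSpace ℝ (Fin d) →ₗ[ℝ] ℝ).isLinear _)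
    refine ⟨(InnerProductSpace.toDual ℝ _).symm f, f p, ?_, ?_, ?_⟩
    · intro x hx
      simp only [mem_ofPred_eq, InnerProductSpace.toDual_symm_apply]
      rcases hB₀F hx with h | h
      · exact (hconst x h).le
      · exact le_of_lt h
    · ext x
      simp only [mem_ofPred_eq, InnerProductSpace.toDual_symm_apply]
      refine ⟨fun ⟨hx, hfx⟩ => ?_, fun hx => ⟨hFB hx, hconst x hx⟩⟩
      rcases hB₀F hx with h | h
      · exact h
      · exact absurd hfx (ne_of_lt h)
    · intro x hx
      rw [InnerProductSpace.toDual_symm_apply]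
      exact hB₁f hx
  · rintro ⟨a, β, hB₀β, hFβ, hB₁β⟩
    have hP : convexHull ℝ ((B₀ ×ˢ ({0} : Set ℝ)) ∪ (B₁ ×ˢ ({1} : Set ℝ))) ⊆
        {q | q.2 = 0 ∧ ⟪a, q.1⟫ ≤ β} ∪ {q | 0 < q.2 ∧ ⟪a, q.1⟫ < β} := by
      refine convexHull_min ?_ ?_
      · rintro ⟨x, t⟩ (⟨hx, ht⟩ | ⟨hx, ht⟩)
        · exact Or.inl ⟨ht, hB₀β hx⟩
        · obtain rfl : t = 1 := ht
          exact Or.inr ⟨one_pos, hB₁β x hx⟩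
      · rw [convex_iff_forall_pos]
        rintro ⟨x, t⟩ hx ⟨y, r⟩ hy k l hk hl hkl
        obtain rfl : l = 1 - k := by linarith
        simp only [mem_union, mem_ofPred_eq, Prod.smul_mk, Prod.mk_add_mk, smul_eq_mul,
          inner_add_right, inner_smul_right] at hx hy ⊢
        rcases hx with ⟨rfl, hx⟩ | ⟨ht, hx⟩ <;> rcases hy with ⟨rfl, hy⟩ | ⟨hr, hy⟩
        · exact Or.inl ⟨by ring, by nlinarith⟩
        · exact Or.inr ⟨by simpa using mul_pos hl hr, by nlinarith⟩
        · exact Or.inr ⟨by simpa using mul_pos hk ht, by nlinarith⟩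
        · exact Or.inr ⟨by positivity, by nlinarith⟩
    rw [eq_empty_iff_forall_notMem]
    rintro ⟨x, t⟩ ⟨⟨hx, ht⟩, hxt⟩
    have hxF : x ∈ F := intrinsicInterior_subset hx
    rw [← hFβ] at hxF
    rcases hP hxt with h | h
    · exact (ne_of_gt ht) h.1
    · exact h.2.ne hxF.2
end

section
/- Let P ⊆ ℝ^d be a polytope with 0 in its interior, and let F be a nonempty proper face of P. Let F^Δ = {y ∈ P* : ∀ x ∈ F, ⟨x, y⟩ = 1} be the conjugate face of F in the polar P*. Then the normal cone of F equals the cone over the conjugate face: ncone(P, F) = {t·y : t ≥ 0, y ∈ F^Δ}. -/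
open RealInnerProductSpace

/-- The polar of a set `P ⊆ ℝⁿ`: `P* = {y | ∀ x ∈ P, ⟪x, y⟫ ≤ 1}`. -/
def polarSet {n : ℕ} (P : Set (EuclideanSpace ℝ (Fin n))) : Set (EuclideanSpace ℝ (Fin n)) :=
  {y | ∀ x ∈ P, ⟪x, y⟫ ≤ 1}

/-- A functional bounded above on a neighbourhood of the origin by `m` has `0 < m`, unless it is
zero. -/
theorem pos_of_forall_inner_le {E : Type*} [NormedAddCommGroup E] [InnerProductSpace ℝ E]
    {P : Set E} (h0 : (0 : E) ∈ interior P) {v : E} (hv : v ≠ 0) {m : ℝ}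
    (hm : ∀ p ∈ P, ⟪v, p⟫ ≤ m) : 0 < m := by
  have hcont : Filter.Tendsto (fun s : ℝ => s • v) (nhdsWithin 0 (Set.Ioi 0)) (nhds 0) := by
    have h : Continuous fun s : ℝ => s • v := by fun_prop
    simpa using (h.tendsto 0).mono_left nhdsWithin_le_nhds
  obtain ⟨s, hsP, hs⟩ :=
    ((hcont.eventually (mem_interior_iff_mem_nhds.mp h0)).and self_mem_nhdsWithin).exists
  have hle := hm _ hsP
  rw [real_inner_smul_right] at hle
  exact (mul_pos hs (real_inner_self_pos.mpr hv)).trans_le hle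

/-- A nonzero vector of the normal cone of `F` is a positive multiple of a point of the conjugate
face. -/
theorem exists_pos_smul_of_mem_ncone {n : ℕ} {P F : Set (EuclideanSpace ℝ (Fin n))}
    (h0 : (0 : EuclideanSpace ℝ (Fin n)) ∈ interior P) (hFP : F ⊆ P) (hFne : F.Nonempty)
    {v : EuclideanSpace ℝ (Fin n)} (hv : v ≠ 0) (hvF : v ∈ ncone P F) :
    ∃ t : ℝ, 0 < t ∧ ∃ y ∈ {y ∈ polarSet P | ∀ x ∈ F, ⟪x, y⟫ = 1}, v = t • y := by
  obtain ⟨f, hf⟩ := hFne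
  have ht : 0 < ⟪v, f⟫ := pos_of_forall_inner_le h0 hv fun p hp => hvF p hp f hf
  refine ⟨⟪v, f⟫, ht, (⟪v, f⟫)⁻¹ • v, ⟨fun x hx => ?_, fun x hx => ?_⟩,
    (smul_inv_smul₀ ht.ne' v).symm⟩
  · rw [real_inner_smul_right, real_inner_comm v x, inv_mul_le_one₀ ht]
    exact hvF x hx f hf
  · rw [real_inner_smul_right, real_inner_comm v x,
      le_antisymm (hvF x (hFP hx) f hf) (hvF f (hFP hf) x hx), inv_mul_cancel₀ ht.ne']

theorem stmt_10 {d : ℕ} (P F : Set (EuclideanSpace ℝ (Fin d)))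
    (hP : IsPolytope P) (h0 : (0 : EuclideanSpace ℝ (Fin d)) ∈ interior P)
    (hF : IsFace P F) (hFne : F.Nonempty) (hFproper : F ≠ P) :
    ncone P F =
      {z | ∃ t : ℝ, 0 ≤ t ∧ ∃ y ∈ {y ∈ polarSet P | ∀ x ∈ F, ⟪x, y⟫ = 1}, z = t • y} := by
  obtain ⟨c, rfl⟩ := hF
  have hFP : {x ∈ P | ∀ y ∈ P, ⟪c, y⟫ ≤ ⟪c, x⟫} ⊆ P := fun x hx => hx.1
  have hc : c ≠ 0 := by
    rintro rfl
    exact hFproper (by simp)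
  ext z
  constructor
  · intro hz
    rcases eq_or_ne z 0 with rfl | hz0
    · obtain ⟨-, -, y, hy, -⟩ :=
        exists_pos_smul_of_mem_ncone h0 hFP hFne hc fun p hp f hf => hf.2 p hp
      exact ⟨0, le_rfl, y, hy, (zero_smul ℝ y).symm⟩
    · obtain ⟨t, ht, h⟩ := exists_pos_smul_of_mem_ncone h0 hFP hFne hz0 hz
      exact ⟨t, ht.le, h⟩
  · rintro ⟨t, ht, y, ⟨hyP, hyF⟩, rfl⟩ p hp f hf
    rw [real_inner_smul_left, real_inner_smul_left, real_inner_comm, real_inner_comm f y, hyF f hf]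
    exact mul_le_mul_of_nonneg_left (hyP p hp) ht
end

section
/- Let v_k = (cos(2πk/5), sin(2πk/5)) for k = 0, 1, 2, 3, 4 be the vertices of a regular pentagon in ℝ². There is no invertible 3×3 real matrix M such that for every k, writing M·(v_k, 1) = (u_k, w_k) with u_k ∈ ℝ² and w_k ∈ ℝ, one has w_k ≠ 0 and u_k / w_k ∈ ℚ². In other words, no projective transformation of the plane maps the regular pentagon to a polygon all of whose vertices have rational coordinates. -/
/-- The homogeneous coordinates `(cos(2πk/5), sin(2πk/5), 1)` of the `k`-th vertex of the
regular pentagon. -/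
noncomputable def pentagonVertexHom (k : Fin 5) : Fin 3 → ℝ :=
  ![Real.cos (2 * Real.pi * (k : ℝ) / 5), Real.sin (2 * Real.pi * (k : ℝ) / 5), 1]

/-- The determinant of the matrix with rows `u`, `v`, `w`. -/
def bracket {R : Type*} [CommRing R] (u v w : Fin 3 → R) : R :=
  Matrix.det (Matrix.of ![u, v, w])

theorem bracket_mulVec {R : Type*} [CommRing R] (M : Matrix (Fin 3) (Fin 3) R)
    (u v w : Fin 3 → R) :
    bracket (M.mulVec u) (M.mulVec v) (M.mulVec w) = M.det * bracket u v w := by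
  simp [bracket, Matrix.det_fin_three, Matrix.mulVec, dotProduct, Fin.sum_univ_three]
  ring

theorem bracket_smul {R : Type*} [CommRing R] (a b c : R) (u v w : Fin 3 → R) :
    bracket (a • u) (b • v) (c • w) = a * b * c * bracket u v w := by
  simp [bracket, Matrix.det_fin_three]
  ring

theorem bracket_ratCast (u v w : Fin 3 → ℚ) :
    bracket (fun i => (u i : ℝ)) (fun i => (v i : ℝ)) (fun i => (w i : ℝ)) =
      (bracket u v w : ℚ) := by
  simp [bracket, Matrix.det_fin_three]

theorem cos_two_pi_div_five : Real.cos (2 * Real.pi / 5) = (√5 - 1) / 4 := by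
  rw [mul_div_assoc, Real.cos_two_mul, Real.cos_pi_div_five]
  have h : √5 ^ 2 = (5 : ℝ) := Real.sq_sqrt (by norm_num)
  linear_combination h / 8

theorem pentagonVertexHom_zero : pentagonVertexHom 0 = ![1, 0, 1] := by
  simp [pentagonVertexHom]

theorem pentagonVertexHom_one : pentagonVertexHom 1 =
    ![Real.cos (2 * Real.pi / 5), Real.sin (2 * Real.pi / 5), 1] := by
  simp [pentagonVertexHom]

theorem pentagonVertexHom_two : pentagonVertexHom 2 =
    ![2 * Real.cos (2 * Real.pi / 5) ^ 2 - 1,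
      2 * Real.sin (2 * Real.pi / 5) * Real.cos (2 * Real.pi / 5), 1] := by
  rw [← Real.cos_two_mul, ← Real.sin_two_mul]
  have h : 2 * Real.pi * (((2 : Fin 5) : ℕ) : ℝ) / 5 = 2 * (2 * Real.pi / 5) := by
    rw [show ((2 : Fin 5) : ℕ) = 2 from rfl]; push_cast; ring
  simp only [pentagonVertexHom, h]

theorem pentagonVertexHom_three : pentagonVertexHom 3 =
    ![2 * Real.cos (2 * Real.pi / 5) ^ 2 - 1,
      -(2 * Real.sin (2 * Real.pi / 5) * Real.cos (2 * Real.pi / 5)), 1] := by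
  rw [← Real.cos_two_mul, ← Real.sin_two_mul]
  have h : 2 * Real.pi * (((3 : Fin 5) : ℕ) : ℝ) / 5 = 2 * Real.pi - 2 * (2 * Real.pi / 5) := by
    rw [show ((3 : Fin 5) : ℕ) = 3 from rfl]; push_cast; ring
  simp only [pentagonVertexHom, h, Real.cos_two_pi_sub, Real.sin_two_pi_sub]

theorem pentagonVertexHom_four : pentagonVertexHom 4 =
    ![Real.cos (2 * Real.pi / 5), -Real.sin (2 * Real.pi / 5), 1] := by
  have h : 2 * Real.pi * (((4 : Fin 5) : ℕ) : ℝ) / 5 = 2 * Real.pi - 2 * Real.pi / 5 := by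
    rw [show ((4 : Fin 5) : ℕ) = 4 from rfl]; push_cast; ring
  simp only [pentagonVertexHom, h, Real.cos_two_pi_sub, Real.sin_two_pi_sub]

theorem pentagon_bracket_ne_zero :
    bracket (pentagonVertexHom 0) (pentagonVertexHom 1) (pentagonVertexHom 2) *
      bracket (pentagonVertexHom 0) (pentagonVertexHom 3) (pentagonVertexHom 4) ≠ 0 := by
  have hs : Real.sin (2 * Real.pi / 5) ≠ 0 :=
    (Real.sin_pos_of_pos_of_lt_pi (by positivity) (by linarith [Real.pi_pos])).ne'
  have hc : 1 - Real.cos (2 * Real.pi / 5) ≠ 0 := by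
    have h : √5 < (5 : ℝ) := by
      rw [Real.sqrt_lt' (by norm_num)]; norm_num
    rw [cos_two_pi_div_five]
    linarith
  have h : bracket (pentagonVertexHom 0) (pentagonVertexHom 1) (pentagonVertexHom 2) *
      bracket (pentagonVertexHom 0) (pentagonVertexHom 3) (pentagonVertexHom 4) =
      (2 * Real.sin (2 * Real.pi / 5) * (1 - Real.cos (2 * Real.pi / 5))) ^ 2 := by
    simp [pentagonVertexHom_zero, pentagonVertexHom_one, pentagonVertexHom_two,
      pentagonVertexHom_three, pentagonVertexHom_four, bracket, Matrix.det_fin_three]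
    ring
  rw [h]
  positivity

/-- The cross-ratio of the pencil of lines from a vertex of the regular pentagon to the other
four vertices is the square of the golden ratio. -/
theorem pentagon_cross_ratio :
    bracket (pentagonVertexHom 0) (pentagonVertexHom 1) (pentagonVertexHom 3) *
      bracket (pentagonVertexHom 0) (pentagonVertexHom 2) (pentagonVertexHom 4) =
    (3 + √5) / 2 *
      (bracket (pentagonVertexHom 0) (pentagonVertexHom 1) (pentagonVertexHom 2) *
        bracket (pentagonVertexHom 0) (pentagonVertexHom 3) (pentagonVertexHom 4)) := by
  have h : (3 + √5) / 2 = (1 + 2 * Real.cos (2 * Real.pi / 5)) ^ 2 := by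
    have h5 : √5 ^ 2 = (5 : ℝ) := Real.sq_sqrt (by norm_num)
    rw [cos_two_pi_div_five]
    linear_combination -h5 / 4
  rw [h]
  simp [pentagonVertexHom_zero, pentagonVertexHom_one, pentagonVertexHom_two,
    pentagonVertexHom_three, pentagonVertexHom_four, bracket, Matrix.det_fin_three]
  ring

theorem stmt_12 :
    ¬ ∃ M : Matrix (Fin 3) (Fin 3) ℝ, IsUnit M.det ∧
      ∀ k : Fin 5,
        M.mulVec (pentagonVertexHom k) 2 ≠ 0 ∧
        (∃ q : ℚ, M.mulVec (pentagonVertexHom k) 0 / M.mulVec (pentagonVertexHom k) 2 = (q : ℝ)) ∧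
        (∃ q : ℚ, M.mulVec (pentagonVertexHom k) 1 / M.mulVec (pentagonVertexHom k) 2 = (q : ℝ)) := by
  rintro ⟨M, hM, h⟩
  have hw := fun k => (h k).1
  choose a ha using fun k => (h k).2.1
  choose b hb using fun k => (h k).2.2
  set w : Fin 5 → ℝ := fun k => M.mulVec (pentagonVertexHom k) 2 with hw_def
  set p : Fin 5 → Fin 3 → ℚ := fun k => ![a k, b k, 1] with hp
  have hv (k : Fin 5) : M.mulVec (pentagonVertexHom k) = w k • fun i => (p k i : ℝ) := by
    have h0 := (div_eq_iff (hw k)).1 (ha k)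
    have h1 := (div_eq_iff (hw k)).1 (hb k)
    funext i
    fin_cases i
    · simpa [hp, hw_def, mul_comm] using h0
    · simpa [hp, hw_def, mul_comm] using h1
    · simp [hp, hw_def]
  have key (i j k : Fin 5) :
      M.det * bracket (pentagonVertexHom i) (pentagonVertexHom j) (pentagonVertexHom k) =
        w i * w j * w k * (bracket (p i) (p j) (p k) : ℚ) := by
    rw [← bracket_mulVec, hv, hv, hv, bracket_smul, bracket_ratCast]
  have hd : M.det ≠ 0 := hM.ne_zero
  have hW : w 0 ^ 2 * w 1 * w 2 * w 3 * w 4 ≠ 0 := by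
    have (k : Fin 5) : w k ≠ 0 := hw k
    simp [this]
  set r : ℚ := bracket (p 0) (p 1) (p 2) * bracket (p 0) (p 3) (p 4) with hr
  set t : ℚ := bracket (p 0) (p 1) (p 3) * bracket (p 0) (p 2) (p 4) with ht
  have hr_eq : M.det ^ 2 *
      (bracket (pentagonVertexHom 0) (pentagonVertexHom 1) (pentagonVertexHom 2) *
        bracket (pentagonVertexHom 0) (pentagonVertexHom 3) (pentagonVertexHom 4)) =
      (w 0 ^ 2 * w 1 * w 2 * w 3 * w 4) * r := by
    have := congrArg₂ (· * ·) (key 0 1 2) (key 0 3 4)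
    simp only [hr, Rat.cast_mul] at this ⊢
    linear_combination this
  have ht_eq : M.det ^ 2 *
      (bracket (pentagonVertexHom 0) (pentagonVertexHom 1) (pentagonVertexHom 3) *
        bracket (pentagonVertexHom 0) (pentagonVertexHom 2) (pentagonVertexHom 4)) =
      (w 0 ^ 2 * w 1 * w 2 * w 3 * w 4) * t := by
    have := congrArg₂ (· * ·) (key 0 1 3) (key 0 2 4)
    simp only [ht, Rat.cast_mul] at this ⊢
    linear_combination this
  have hr0 : (r : ℝ) ≠ 0 := by
    intro h0
    rw [h0, mul_zero] at hr_eq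
    exact mul_ne_zero (pow_ne_zero 2 hd) pentagon_bracket_ne_zero hr_eq
  have htr : (t : ℝ) = (3 + √5) / 2 * r := by
    apply mul_left_cancel₀ hW
    rw [pentagon_cross_ratio] at ht_eq
    linear_combination (3 + √5) / 2 * hr_eq - ht_eq
  have hirr : Irrational √(5 : ℝ) := by
    simpa using (by norm_num : Nat.Prime 5).irrational_sqrt
  refine hirr ⟨2 * t / r - 3, ?_⟩
  push_cast
  rw [htr]
  field_simp
  ring
end
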